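/- arXiv:2108.09390 — 3 statements merged into one kernel-verified Lean document; each statement's English description precedes it below -/
import Mathlib

section
/- Let G be a finitely generated group with a finite index normal subgroup H, and let Ω ≤ Aut(H) be the group of automorphisms of H induced by conjugation by elements of G. Fix a finite generating set Σ_H of H, a normal form η_H for (H, Σ_H), and a right transversal T of H in G, and let η be the inherited normal form for (G, Σ_H ⊔ T) given by η(g) = η_H(h_g) t_g. If for every finite system of Ω-twisted equations with rational constraints in H the solution language with respect to η_H is EDT0L, then for every finite system of equations with rational constraints in G the solution language with respect to η is EDT0L. -/
namespace Paper

/-- Apply a letterwise substitution (i.e. the endomorphism of the free monoid `C*`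
determined by its action on letters) to a word over `C`. -/
def subApply {C : Type*} (f : C → List C) (w : List C) : List C := (w.map f).flatten

/-- An EDT0L system: a finite extended alphabet `C`, an identification of some letters of
`C` with terminal letters of the alphabet `α` (injectively, modelling `Σ ⊆ C`), a start
word over `C`, and a rational control: a regular language over a finite set of letterwise
substitutions (endomorphisms of `C*`), a word of endomorphisms acting by composition. -/
structure EDT0LSystem (α : Type*) where
  C : Type
  finC : Fintype C
  term : C → Option α
  term_inj : ∀ c c' a, term c = some a → term c' = some a → c = c'
  start : List C
  ι : Type
  finι : Fintype ι
  tab : ι → C → List C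
  control : Language ι
  control_reg : control.IsRegular

/-- The endomorphism of `C*` given by a word of basic endomorphisms, applied to `w`
(the word `φ₁φ₂⋯φₖ` acts as `φ₁∘φ₂∘⋯∘φₖ`, functions written on the right). -/
def EDT0LSystem.apply {α : Type*} (S : EDT0LSystem α) (φs : List S.ι) (w : List S.C) :
    List S.C :=
  φs.foldl (fun v i => subApply (S.tab i) v) w

/-- The language accepted by an EDT0L system: `{ωφ : φ ∈ R} ∩ Σ*`. -/
def EDT0LSystem.accepts {α : Type*} (S : EDT0LSystem α) : Language α :=
  { w | ∃ φs ∈ S.control, (S.apply φs S.start).map S.term = w.map Option.some }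

/-- A language is EDT0L if it is accepted by some EDT0L system. -/
def IsEDT0L {α : Type*} (L : Language α) : Prop := ∃ S : EDT0LSystem α, S.accepts = L

/-- Evaluate a word over the alphabet `Σ ∪ Σ⁻¹` (a letter is a generator index together
with a sign) in a group. -/
def evalWord {G : Type*} [Group G] {ι : Type*} (gen : ι → G) (w : List (ι × Bool)) : G :=
  (w.map fun l => if l.2 then gen l.1 else (gen l.1)⁻¹).prod

/-- The word length of `g` with respect to the generating set `gen`. -/
noncomputable def wordLength {G : Type*} [Group G] {ι : Type*} (gen : ι → G) (g : G) : ℕ :=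
  sInf {n | ∃ w : List (ι × Bool), evalWord gen w = g ∧ w.length = n}

/-- A normal form is quasigeodesic if `|η(g)| ≤ λ·|g| + λ` for some `λ > 0`. -/
def IsQuasigeodesicNF {G : Type*} [Group G] {ι : Type*} (gen : ι → G)
    (η : G → List (ι × Bool)) : Prop :=
  ∃ lam : ℝ, 0 < lam ∧ ∀ g : G, ((η g).length : ℝ) ≤ lam * (wordLength gen g) + lam

/-- A normal form is regular if its image is a regular language. -/
def IsRegularNF {G : Type*} [Group G] {ι : Type*} (η : G → List (ι × Bool)) : Prop :=
  Language.IsRegular (Set.range η : Language (ι × Bool))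

/-- A subset of a group is rational if it is the image of a regular language under the
evaluation map from the free monoid on a finite monoid generating set. -/
def IsRationalSubset {G : Type*} [Group G] (A : Set G) : Prop :=
  ∃ (ι : Type) (_ : Fintype ι) (gen : ι → G) (L : Language ι),
    Submonoid.closure (Set.range gen) = ⊤ ∧ L.IsRegular ∧
      A = (fun w : List ι => (w.map gen).prod) '' L

/-- A subset of a group is recognisable if its full preimage under the evaluation map
from the free monoid on a finite monoid generating set is a regular language. -/
def IsRecognisableSubset {G : Type*} [Group G] (A : Set G) : Prop :=
  ∃ (ι : Type) (_ : Fintype ι) (gen : ι → G),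
    Submonoid.closure (Set.range gen) = ⊤ ∧
      Language.IsRegular ({w : List ι | (w.map gen).prod ∈ A} : Language ι)

/-- The word `w₁ # w₂ # ⋯ # wₘ` over `β ⊕ {#}`. -/
def hashWord {β : Type*} {m : ℕ} (ws : Fin m → List β) : List (β ⊕ Unit) :=
  List.intercalate [Sum.inr ()] (List.ofFn fun i => (ws i).map Sum.inl)

/-- `g : Fin m → G` is a solution of the system `E ⊆ G ∗ F_X` of equations. -/
def SolvesSystem {G : Type*} [Group G] {m : ℕ}
    (E : Set (Monoid.Coprod G (FreeGroup (Fin m)))) (g : Fin m → G) : Prop :=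
  ∀ e ∈ E, Monoid.Coprod.lift (MonoidHom.id G) (FreeGroup.lift g) e = 1

/-- The solution language of a system of equations with constraints, w.r.t. a normal form. -/
def solutionLanguageC {G : Type*} [Group G] {ι : Type*} (η : G → List (ι × Bool)) {m : ℕ}
    (E : Set (Monoid.Coprod G (FreeGroup (Fin m)))) (Rc : Fin m → Set G) :
    Language ((ι × Bool) ⊕ Unit) :=
  { w | ∃ g : Fin m → G, SolvesSystem E g ∧ (∀ i, g i ∈ Rc i) ∧
      w = hashWord fun i => η (g i) }

/-- The solution language of a system of equations, w.r.t. a normal form. -/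
def solutionLanguage {G : Type*} [Group G] {ι : Type*} (η : G → List (ι × Bool)) {m : ℕ}
    (E : Set (Monoid.Coprod G (FreeGroup (Fin m)))) : Language ((ι × Bool) ⊕ Unit) :=
  solutionLanguageC η E fun _ => Set.univ

/-- Evaluate a twisted word (a word over `H ∪ (F_X × Ω)`) at the assignment `g` of the
variables: each letter `(u, ψ)` becomes `ψ(uφ)` where `φ` is the homomorphism `F_X → H`
determined by `g`, and the word is multiplied out in `H`. -/
def twistedEval {H : Type*} [Group H] {m : ℕ} (Ω : Subgroup (MulAut H)) (g : Fin m → H)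
    (w : List (H ⊕ (FreeGroup (Fin m) × Ω))) : H :=
  (w.map (Sum.elim id fun p => (p.2 : MulAut H) (FreeGroup.lift g p.1))).prod

/-- The solution language of a system of `Ω`-twisted equations with constraints. -/
def twistedSolutionLanguage {H : Type*} [Group H] {ι : Type*} (Ω : Subgroup (MulAut H))
    (η : H → List (ι × Bool)) {m : ℕ}
    (E : Set (List (H ⊕ (FreeGroup (Fin m) × Ω)))) (Rc : Fin m → Set H) :
    Language ((ι × Bool) ⊕ Unit) :=
  { w | ∃ g : Fin m → H, (∀ e ∈ E, twistedEval Ω g e = 1) ∧ (∀ i, g i ∈ Rc i) ∧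
      w = hashWord fun i => η (g i) }

section Words

variable {C D : Type*}

@[simp] theorem subApply_nil (f : C → List C) : subApply f [] = [] := rfl

@[simp] theorem subApply_cons (f : C → List C) (c : C) (w : List C) :
    subApply f (c :: w) = f c ++ subApply f w := rfl

@[simp] theorem subApply_append (f : C → List C) (v w : List C) :
    subApply f (v ++ w) = subApply f v ++ subApply f w := by
  simp [subApply]

theorem mem_subApply_of_mem {f : C → List C} {c d : C} {w : List C} (hc : c ∈ w)
    (hd : d ∈ f c) : d ∈ subApply f w := by
  simp only [subApply, List.mem_flatten, List.mem_map]
  exact ⟨_, ⟨c, hc, rfl⟩, hd⟩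

theorem subApply_map_of_fixed {f : C → List C} {g : D → C} (h : ∀ d, f (g d) = [g d])
    (w : List D) : subApply f (w.map g) = w.map g := by
  induction w with
  | nil => rfl
  | cons d w ih => simp [h, ih]

end Words

section Transducer

variable {α β C Q : Type*}

/-- The output of the sequential transducer with transition function `δ` and output function
`o`, started in a given state. -/
def transduce (δ : Q → α → Q) (o : Q → α → List β) : Q → List α → List β
  | _, [] => []
  | p, a :: w => o p a ++ transduce δ o (δ p a) w

/-- The state reached by reading a word, `f c` being the action of the letter `c` on states. -/
def runStates (f : C → Q → Q) (p : Q) (w : List C) : Q := w.foldl (fun p c => f c p) p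

/-- Annotate each letter of a word with the states before and after reading it. -/
def annotate (f : C → Q → Q) : Q → List C → List (Q × C × Q)
  | _, [] => []
  | p, c :: w => (p, c, f c p) :: annotate f (f c p) w

/-- The annotated word is a path from one state to another. -/
def IsPath : Q → List (Q × C × Q) → Q → Prop
  | p, [], q => p = q
  | p, x :: l, q => x.1 = p ∧ IsPath x.2.2 l q

theorem IsPath.append {p q r : Q} {l l' : List (Q × C × Q)} (h : IsPath p l q)
    (h' : IsPath q l' r) : IsPath p (l ++ l') r := by
  induction l generalizing p with
  | nil => cases h; exact h'
  | cons x l ih => exact ⟨h.1, ih h.2⟩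

theorem isPath_annotate (f : C → Q → Q) (p : Q) (w : List C) :
    IsPath p (annotate f p w) (runStates f p w) := by
  induction w generalizing p with
  | nil => rfl
  | cons c w ih => exact ⟨rfl, ih _⟩

@[simp] theorem map_annotate (f : C → Q → Q) (p : Q) (w : List C) :
    (annotate f p w).map (fun x => x.2.1) = w := by
  induction w generalizing p with
  | nil => rfl
  | cons c w ih => simp [annotate, ih]

theorem annotate_append (f : C → Q → Q) (p : Q) (v w : List C) :
    annotate f p (v ++ w) = annotate f p v ++ annotate f (runStates f p v) w := by
  induction v generalizing p with
  | nil => rfl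
  | cons c v ih => simp [annotate, runStates, ih]

end Transducer

section TransducedUnion

/-- The letters of the system accepting a finite union of transduced EDT0L languages. -/
inductive UnionLetter {α κ : Type} (S : κ → EDT0LSystem α) (σ : κ → Type) (Q β : Type)
  | start
  | dead
  | out (b : β)
  | ctl (k : κ) (s : σ k)
  | mid (k : κ) (x : Q × (S k).C × Q)

variable {α κ β Q : Type} {σ : κ → Type} (S : κ → EDT0LSystem α)
  (M : ∀ k, DFA (S k).ι (σ k))

open UnionLetter

theorem finite_unionLetter [Finite κ] [Finite Q] [Finite β] [∀ k, Finite (σ k)] :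
    Finite (UnionLetter S σ Q β) := by
  have := fun k => (S k).finC
  refine Finite.of_surjective
    (fun x : Bool ⊕ β ⊕ (Σ k, σ k) ⊕ (Σ k, Q × (S k).C × Q) =>
      match x with
      | .inl true => (start : UnionLetter S σ Q β)
      | .inl false => dead
      | .inr (.inl b) => out b
      | .inr (.inr (.inl s)) => ctl s.1 s.2
      | .inr (.inr (.inr x)) => mid x.1 x.2) ?_
  rintro (_ | _ | b | ⟨k, s⟩ | ⟨k, x⟩)
  · exact ⟨.inl true, rfl⟩
  · exact ⟨.inl false, rfl⟩
  · exact ⟨.inr (.inl b), rfl⟩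
  · exact ⟨.inr (.inr (.inl ⟨k, s⟩)), rfl⟩
  · exact ⟨.inr (.inr (.inr ⟨k, x⟩)), rfl⟩

variable (Q) in
/-- The substitutions of the union system: pick a member of the family, perform a step in
each member, or finish. The state maps are guesses of the actions of the letters. -/
abbrev UnionIndex : Type :=
  (Σ k, (S k).C → Q → Q) ⊕ (∀ k, Option ((S k).ι × ((S k).C → Q → Q))) ⊕ Unit

variable (δ : Q → α → Q) (o : κ → Q → α → List β) (q₀ : Q) (u : κ → List β)

/-- The substitution picking the `k`-th member. -/
def startTab (k : κ) (f : (S k).C → Q → Q) : UnionLetter S σ Q β → List (UnionLetter S σ Q β)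
  | start => (annotate f q₀ (S k).start).map (mid k) ++ [ctl k (M k).start]
  | out b => [out b]
  | _ => [dead]

open Classical in
/-- The substitution performing a step. -/
noncomputable def stepTab (F : ∀ k, Option ((S k).ι × ((S k).C → Q → Q))) :
    UnionLetter S σ Q β → List (UnionLetter S σ Q β)
  | start => [dead]
  | dead => [dead]
  | out b => [out b]
  | ctl k s => match F k with
    | none => [dead]
    | some z => [ctl k ((M k).step s z.1)]
  | mid k x => match F k with
    | none => [dead]
    | some z => if runStates z.2 x.1 ((S k).tab z.1 x.2.1) = x.2.2 then
        (annotate z.2 x.1 ((S k).tab z.1 x.2.1)).map (mid k) else [dead]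

open Classical in
/-- The substitution producing the output. -/
noncomputable def finalTab : UnionLetter S σ Q β → List (UnionLetter S σ Q β)
  | start => [dead]
  | dead => [dead]
  | out b => [out b]
  | ctl k s => if s ∈ (M k).accept then (u k).map out else [dead]
  | mid k x => match (S k).term x.2.1 with
    | none => [dead]
    | some a => if δ x.1 a = x.2.2 then (o k x.1 a).map out else [dead]

/-- The substitutions of the union system. -/
noncomputable def unionTab (i : UnionIndex Q S) :
    UnionLetter S σ Q β → List (UnionLetter S σ Q β) :=
  match i with
  | .inl z => startTab S M q₀ z.1 z.2
  | .inr (.inl F) => stepTab S M F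
  | .inr (.inr ()) => finalTab S M δ o u

/-- The terminal letters of the union system. -/
def unionTerm : UnionLetter S σ Q β → Option β
  | out b => some b
  | _ => none

/-- The effect of a word of substitutions of the union system. -/
noncomputable def unionApply (φs : List (UnionIndex Q S)) (w : List (UnionLetter S σ Q β)) :
    List (UnionLetter S σ Q β) :=
  φs.foldl (fun v i => subApply (unionTab S M δ o q₀ u i) v) w

/-- The system accepting the union of the transduced languages of a finite family. -/
noncomputable def unionSystem [Finite κ] [Finite Q] [Finite β] [∀ k, Finite (σ k)] :
    EDT0LSystem β where
  C := UnionLetter S σ Q β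
  finC := @Fintype.ofFinite _ (finite_unionLetter S)
  term := unionTerm S
  term_inj := by
    rintro (_ | _ | b | _ | _) (_ | _ | b' | _ | _) a <;> simp [unionTerm]
    rintro rfl h
    exact h.symm
  start := [start]
  ι := UnionIndex Q S
  finι :=
    have := fun k => (S k).finC
    have := fun k => (S k).finι
    @Fintype.ofFinite _ inferInstance
  tab := unionTab S M δ o q₀ u
  control := Set.univ
  control_reg := ⟨Unit, inferInstance, ⟨fun _ _ => (), (), Set.univ⟩, by
    ext; simp [DFA.mem_accepts]; trivial⟩

theorem subApply_stepTab_mid {F : ∀ k, Option ((S k).ι × ((S k).C → Q → Q))} {k : κ}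
    {l : List (Q × (S k).C × Q)} {p q : Q} (hl : IsPath p l q) {z}
    (hz : F k = some z) :
    (dead : UnionLetter S σ Q β) ∈ subApply (stepTab S M F) (l.map (mid k)) ∨
    ∃ l', IsPath p l' q ∧
      l'.map (fun x => x.2.1) = subApply ((S k).tab z.1) (l.map fun x => x.2.1) ∧
      subApply (stepTab S M F) (l.map (mid k)) =
        (l'.map (mid k) : List (UnionLetter S σ Q β)) := by
  induction l generalizing p with
  | nil => exact .inr ⟨[], hl, rfl, rfl⟩
  | cons x l ih =>
    obtain ⟨rfl, hl⟩ := hl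
    by_cases h : runStates z.2 x.1 ((S k).tab z.1 x.2.1) = x.2.2
    · obtain h' | ⟨l', h₁, h₂, h₃⟩ := ih hl
      · left; simp [h']
      · refine .inr ⟨annotate z.2 x.1 ((S k).tab z.1 x.2.1) ++ l', ?_, ?_, ?_⟩
        · exact (isPath_annotate _ _ _).append (h ▸ h₁)
        · simp [h₂]
        · simp [stepTab, hz, h, h₃]
    · left; simp [stepTab, hz, h]

theorem subApply_finalTab_mid {k : κ} {l : List (Q × (S k).C × Q)} {p q : Q}
    (hl : IsPath p l q) :
    (dead : UnionLetter S σ Q β) ∈ subApply (finalTab S M δ o u) (l.map (mid k)) ∨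
    ∃ v : List α, (l.map fun x => x.2.1).map (S k).term = v.map some ∧
      subApply (finalTab S M δ o u) (l.map (mid k)) = (transduce δ (o k) p v).map out := by
  induction l generalizing p with
  | nil => exact .inr ⟨[], rfl, rfl⟩
  | cons x l ih =>
    obtain ⟨rfl, hl⟩ := hl
    rcases ha : (S k).term x.2.1 with _ | a
    · left; simp [finalTab, ha]
    by_cases h : δ x.1 a = x.2.2
    · obtain h' | ⟨v, h₁, h₂⟩ := ih hl
      · left; simp [h']
      · refine .inr ⟨a :: v, ?_, ?_⟩
        · simpa [ha] using h₁
        · simp [finalTab, ha, h, h₂, transduce]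
    · left; simp [finalTab, ha, h]

/-- The words derivable in the union system. -/
inductive UnionReachable : List (UnionLetter S σ Q β) → Prop
  | start : UnionReachable [start]
  | dead {w} : dead ∈ w → UnionReachable w
  | mid (k : κ) (φs : List (S k).ι) (l : List (Q × (S k).C × Q)) (q : Q) :
      IsPath q₀ l q → l.map (fun x => x.2.1) = (S k).apply φs (S k).start →
      UnionReachable (l.map (mid k) ++ [ctl k ((M k).eval φs)])
  | out (k : κ) (v : List α) : v ∈ (S k).accepts →
      UnionReachable ((transduce δ (o k) q₀ v ++ u k).map out)

variable {S M δ o q₀ u}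

theorem UnionReachable.subApply
    (hM : ∀ k, (M k).accepts = (S k).control)
    {w : List (UnionLetter S σ Q β)} (h : UnionReachable S M δ o q₀ u w)
    (i : UnionIndex Q S) :
    UnionReachable S M δ o q₀ u (subApply (unionTab S M δ o q₀ u i) w) := by
  cases h with
  | start =>
    rcases i with ⟨k, f⟩ | F | ⟨⟩
    · have := UnionReachable.mid (M := M) (δ := δ) (o := o) (u := u) k []
        (annotate f q₀ (S k).start) _ (isPath_annotate f q₀ _) (by simp [EDT0LSystem.apply])
      simpa [unionTab, startTab] using this
    · exact .dead (by simp [unionTab, stepTab])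
    · exact .dead (by simp [unionTab, finalTab])
  | dead h =>
    refine .dead (mem_subApply_of_mem h ?_)
    rcases i with ⟨k, f⟩ | F | ⟨⟩ <;> simp [unionTab, startTab, stepTab, finalTab]
  | mid k φs l q hl hφ =>
    rcases i with ⟨k', f⟩ | F | ⟨⟩
    · exact .dead (mem_subApply_of_mem (c := ctl k ((M k).eval φs)) (by simp)
        (by simp [unionTab, startTab]))
    · rcases hz : F k with _ | z
      · exact .dead (mem_subApply_of_mem (c := ctl k ((M k).eval φs)) (by simp)
          (by simp [unionTab, stepTab, hz]))
      obtain h | ⟨l', h₁, h₂, h₃⟩ := subApply_stepTab_mid (σ := σ) (β := β) S M hl hz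
      · exact .dead (by simp [unionTab, h])
      · have := UnionReachable.mid (M := M) (δ := δ) (o := o) (u := u) k (φs ++ [z.1]) l' q h₁
          (by simp [h₂, hφ, EDT0LSystem.apply])
        simpa [unionTab, stepTab, hz, h₃] using this
    · by_cases hacc : (M k).eval φs ∈ (M k).accept
      · obtain h | ⟨v, h₁, h₂⟩ := subApply_finalTab_mid (σ := σ) S M δ o u hl
        · exact .dead (by simp [unionTab, h])
        · have := UnionReachable.out (M := M) (δ := δ) (o := o) (q₀ := q₀) (u := u) k v
            ⟨φs, by rw [← hM]; exact hacc, by rw [← hφ]; exact h₁⟩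
          simpa [unionTab, finalTab, hacc, h₂] using this
      · exact .dead (by simp [unionTab, finalTab, hacc])
  | out k v hv =>
    rw [subApply_map_of_fixed]
    · exact .out k v hv
    · intro b
      rcases i with ⟨k', f⟩ | F | ⟨⟩ <;> rfl

/-- The action on transducer states of the word that a letter derives under `φs`. -/
def derivedAction (S : EDT0LSystem α) (δ : Q → α → Q) : List S.ι → S.C → Q → Q
  | [], c, p => match S.term c with
    | some a => δ p a
    | none => p
  | i :: φs, c, p => runStates (derivedAction S δ φs) p (S.tab i c)

open Classical in
/-- The steps of the union system simulating a derivation in the `k`-th member. -/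
noncomputable def simSteps (S : κ → EDT0LSystem α) (δ : Q → α → Q) (k : κ) :
    List (S k).ι → List (UnionIndex Q S)
  | [] => []
  | i :: φs => .inr (.inl (Function.update (fun _ => none) k
      (some (i, derivedAction (S k) δ φs)))) :: simSteps S δ k φs

theorem subApply_stepTab_annotate {F : ∀ k, Option ((S k).ι × ((S k).C → Q → Q))} {k : κ}
    {i : (S k).ι} {f g : (S k).C → Q → Q} (hF : F k = some (i, f))
    (h : ∀ c p, g c p = runStates f p ((S k).tab i c)) (p : Q) (w : List (S k).C) :
    subApply (stepTab S M F) ((annotate g p w).map (mid k)) =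
      ((annotate f p (subApply ((S k).tab i) w)).map (mid k) :
        List (UnionLetter S σ Q β)) := by
  induction w generalizing p with
  | nil => rfl
  | cons c w ih => simp [annotate, stepTab, hF, ih, h, annotate_append]

theorem unionApply_simSteps (k : κ)
    (φs : List (S k).ι) (p : Q) (w : List (S k).C) (s : σ k) :
    unionApply S M δ o q₀ u (simSteps S δ k φs)
      ((annotate (derivedAction (S k) δ φs) p w).map (mid k) ++ [ctl k s]) =
    (annotate (derivedAction (S k) δ []) p ((S k).apply φs w)).map (mid k) ++
      [ctl k ((M k).evalFrom s φs)] := by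
  induction φs generalizing w s with
  | nil => rfl
  | cons i φs ih =>
    have h := ih (Paper.subApply ((S k).tab i) w) ((M k).step s i)
    simp only [unionApply, EDT0LSystem.apply, simSteps, List.foldl_cons, DFA.evalFrom_cons] at h ⊢
    rw [← h]
    congr 1
    simp only [unionTab, subApply_append]
    rw [subApply_stepTab_annotate (g := derivedAction (S k) δ (i :: φs)) (i := i)
      (f := derivedAction (S k) δ φs) (by simp) (fun _ _ => rfl)]
    simp [stepTab]

theorem subApply_finalTab_annotate {k : κ} {w : List (S k).C} {v : List α}
    (h : w.map (S k).term = v.map some) (p : Q) :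
    subApply (finalTab S M δ o u) ((annotate (derivedAction (S k) δ []) p w).map (mid k)) =
      (transduce δ (o k) p v).map out := by
  induction w generalizing p v with
  | nil =>
    cases v
    · rfl
    · simp at h
  | cons c w ih =>
    cases v with
    | nil => simp at h
    | cons a v =>
      simp only [List.map_cons, List.cons.injEq] at h
      have := ih h.2 (δ p a)
      simp [annotate, finalTab, h.1, derivedAction, transduce] at this ⊢
      exact this

/-- Images of EDT0L languages under sequential transducers with a word appended, and finite
unions of such, are EDT0L. -/
theorem isEDT0L_iUnion_transduce [Finite κ] [Finite Q] [Finite β] {L : κ → Language α}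
    (hL : ∀ k, IsEDT0L (L k)) (δ : Q → α → Q) (o : κ → Q → α → List β) (q₀ : Q)
    (u : κ → List β) :
    IsEDT0L ({w | ∃ k, ∃ v ∈ L k, w = transduce δ (o k) q₀ v ++ u k} : Language β) := by
  choose S hS using hL
  choose σ hσ M hM using fun k => (S k).control_reg
  refine ⟨unionSystem S M δ o q₀ u, Set.ext fun w => ⟨?_, ?_⟩⟩
  · rintro ⟨φs, -, h⟩
    have key : ∀ (φs : List (UnionIndex Q S)) w, UnionReachable S M δ o q₀ u w →
        UnionReachable S M δ o q₀ u (unionApply S M δ o q₀ u φs w) := by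
      intro φs
      induction φs with
      | nil => exact fun _ h => h
      | cons i φs ih => exact fun w h => ih _ (h.subApply hM i)
    have := key φs _ .start
    change (unionApply S M δ o q₀ u φs [start]).map (unionTerm S) = _ at h
    generalize unionApply S M δ o q₀ u φs [start] = x at h this
    cases this with
    | start =>
      rcases w with _ | ⟨b, _⟩ <;> simp [unionTerm] at h
    | dead hd =>
      have := List.mem_map_of_mem (f := unionTerm (β := β) S) hd
      rw [h] at this
      simp [unionTerm] at this
    | mid k φs l q hl hφ =>
      have := List.mem_map_of_mem (f := unionTerm (β := β) S)
        (List.mem_append_right (l.map (mid k)) (List.mem_singleton_self (ctl k ((M k).eval φs))))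
      rw [h] at this
      simp [unionTerm] at this
    | out k v hv =>
      refine ⟨k, v, hS k ▸ hv, ?_⟩
      rw [List.map_map] at h
      exact (List.map_injective_iff.2 (Option.some_injective β) h).symm
  · rintro ⟨k, v, hv, rfl⟩
    rw [← hS k] at hv
    obtain ⟨φs, hφ, h⟩ := hv
    have hacc : (M k).evalFrom (M k).start φs ∈ (M k).accept := by
      rw [← hM k] at hφ; exact hφ
    refine ⟨.inl ⟨k, derivedAction (S k) δ φs⟩ :: (simSteps S δ k φs ++ [.inr (.inr ())]),
      trivial, ?_⟩
    have h₁ := unionApply_simSteps (M := M) (o := o) (q₀ := q₀) (u := u) (δ := δ) k φs q₀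
      (S k).start (M k).start
    have h₂ := subApply_finalTab_annotate (M := M) (δ := δ) (o := o) (u := u) h q₀
    have h₃ : unionApply S M δ o q₀ u
        (.inl ⟨k, derivedAction (S k) δ φs⟩ :: (simSteps S δ k φs ++ [.inr (.inr ())]))
        [start] = (transduce δ (o k) q₀ v ++ u k).map out := by
      simp only [unionApply, List.foldl_cons, List.foldl_append, List.foldl_nil] at h₁ ⊢
      have h₄ : subApply (unionTab S M δ o q₀ u
          (.inl ⟨k, derivedAction (S k) δ φs⟩)) [start] =
          (annotate (derivedAction (S k) δ φs) q₀ (S k).start).map (mid k) ++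
            [ctl k (M k).start] := by
        simp [unionTab, startTab]
      rw [h₄, h₁, subApply_append]
      simp only [unionTab]
      rw [h₂]
      simp [finalTab, hacc]
    refine (congrArg (List.map (unionTerm S)) h₃).trans ?_
    rw [List.map_map]
    rfl

end TransducedUnion

section HashWord

theorem hashWord_succ_succ {β : Type*} {n : ℕ} (ws : Fin (n + 2) → List β) :
    hashWord ws = (ws 0).map Sum.inl ++ Sum.inr () :: hashWord fun i => ws i.succ := by
  simp [hashWord, List.ofFn_succ]

/-- Transitions of the transducer that changes state at every `#`. -/
def hashStep {A Q : Type*} (next : Q → Q) (p : Q) : A ⊕ Unit → Q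
  | .inl _ => p
  | .inr _ => next p

/-- Output of the transducer that inserts a letter depending on the state before every `#`. -/
def hashOutput {A B Q : Type*} (f : A → B) (T : Q → B) (p : Q) : A ⊕ Unit → List (B ⊕ Unit)
  | .inl a => [.inl (f a)]
  | .inr _ => [.inl (T p), .inr ()]

theorem transduce_hash_append {A B Q : Type*} (f : A → B) (T : Q → B) (next : Q → Q) (p : Q)
    (w : List A) (v : List (A ⊕ Unit)) :
    transduce (hashStep next) (hashOutput f T) p (w.map Sum.inl ++ v) =
      (w.map f).map Sum.inl ++ transduce (hashStep next) (hashOutput f T) p v := by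
  induction w with
  | nil => rfl
  | cons a w ih => simp [transduce, hashStep, hashOutput] at ih ⊢; exact ih

theorem exists_transduce_hashWord {A B Q : Type*} (f : A → B) (T : Q → B) (next : Q → Q)
    (n : ℕ) (p : Q) : ∃ u, ∀ ws : Fin n → List A,
      transduce (hashStep next) (hashOutput f T) p (hashWord ws) ++ u =
        hashWord fun i => (ws i).map f ++ [T (next^[i] p)] := by
  induction n generalizing p with
  | zero => exact ⟨[], fun ws => rfl⟩
  | succ n ih =>
    cases n with
    | zero =>
      refine ⟨[.inl (T p)], fun ws => ?_⟩
      have := transduce_hash_append f T next p (ws 0) []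
      simp only [List.append_nil] at this
      simp [hashWord, this, transduce]
    | succ n =>
      obtain ⟨u, hu⟩ := ih (next p)
      refine ⟨u, fun ws => ?_⟩
      rw [hashWord_succ_succ, hashWord_succ_succ, transduce_hash_append]
      simp only [transduce, hashStep, hashOutput, List.append_assoc, hu]
      simp

end HashWord

section Twisted

variable {G : Type*} [Group G] {H : Subgroup G} {m : ℕ}

theorem twistedEval_append {K : Type*} [Group K] (Ω : Subgroup (MulAut K)) (g : Fin m → K)
    (v w : List (K ⊕ (FreeGroup (Fin m) × Ω))) :
    twistedEval Ω g (v ++ w) = twistedEval Ω g v * twistedEval Ω g w := by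
  simp [twistedEval]

variable [H.Normal]

theorem exists_twistedEval_eq_conj (c : G)
    (W : List (H ⊕ (FreeGroup (Fin m) × (MulAut.conjNormal (H := H)).range))) :
    ∃ W' : List (H ⊕ (FreeGroup (Fin m) × (MulAut.conjNormal (H := H)).range)),
      ∀ h : Fin m → H, ((twistedEval _ h W' : H) : G) = c * (twistedEval _ h W : H) * c⁻¹ := by
  refine ⟨W.map (Sum.map (MulAut.conjNormal c)
    fun p => (p.1, ⟨MulAut.conjNormal c, c, rfl⟩ * p.2)), fun h => ?_⟩
  induction W with
  | nil => simp [twistedEval]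
  | cons x W ih =>
    rcases x with x | x <;> simp [twistedEval] at ih ⊢ <;> rw [ih] <;> group

variable (H) in
/-- The value of `e` at any `hᵢ tᵢ` with `hᵢ ∈ H` is a fixed twisted word in the `hᵢ` times the
value of `e` at the `tᵢ`. -/
def HasTwistedForm (t : Fin m → G) (e : Monoid.Coprod G (FreeGroup (Fin m))) : Prop :=
  ∃ W : List (H ⊕ (FreeGroup (Fin m) × (MulAut.conjNormal (H := H)).range)),
    ∀ h : Fin m → H,
      Monoid.Coprod.lift (MonoidHom.id G) (FreeGroup.lift fun i => (h i : G) * t i) e =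
        (twistedEval _ h W : H) * Monoid.Coprod.lift (MonoidHom.id G) (FreeGroup.lift t) e

theorem HasTwistedForm.mul {t : Fin m → G} {x y : Monoid.Coprod G (FreeGroup (Fin m))}
    (hx : HasTwistedForm H t x) (hy : HasTwistedForm H t y) : HasTwistedForm H t (x * y) := by
  obtain ⟨W₁, h₁⟩ := hx
  obtain ⟨W₂, h₂⟩ := hy
  obtain ⟨W', hW'⟩ := exists_twistedEval_eq_conj
    (Monoid.Coprod.lift (MonoidHom.id G) (FreeGroup.lift t) x) W₂
  refine ⟨W₁ ++ W', fun h => ?_⟩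
  rw [map_mul, map_mul, h₁, h₂, twistedEval_append, Subgroup.coe_mul, hW']
  group

theorem hasTwistedForm (t : Fin m → G) (e : Monoid.Coprod G (FreeGroup (Fin m))) :
    HasTwistedForm H t e := by
  induction e using Monoid.Coprod.induction_on with
  | inl g => exact ⟨[], fun h => by simp [twistedEval]⟩
  | inr x =>
    refine FreeGroup.induction_on
      (C := fun x => HasTwistedForm H t (Monoid.Coprod.inr x)) x ?_ ?_ ?_ ?_
    · exact ⟨[], fun h => by simp [twistedEval]⟩
    · exact fun i => ⟨[.inr (FreeGroup.of i, 1)], fun h => by simp [twistedEval]⟩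
    · exact fun i _ => ⟨[.inr ((FreeGroup.of i)⁻¹, ⟨MulAut.conjNormal (t i)⁻¹, _, rfl⟩)],
        fun h => by simp [twistedEval, mul_assoc]⟩
    · intro x y hx hy
      rw [map_mul]
      exact hx.mul hy
  | mul x y hx hy => exact hx.mul hy

end Twisted

section Rational

variable {G : Type} [Group G] {H : Subgroup G} [H.Normal] {ι J σ : Type}

/-- The Schreier generators of `H` with respect to a section `s` of `G → G ⧸ H`, together with
the inverse of `s 1` and further generators. -/
def schreierGen (gen : ι → G) (s : G ⧸ H → G) (hs : ∀ q, (s q : G ⧸ H) = q) (genH : J → H) :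
    Option ((G ⧸ H) × ι) ⊕ J → H
  | .inl none => ⟨(s 1)⁻¹, (QuotientGroup.eq_one_iff _).1 (by simp [hs])⟩
  | .inl (some x) => ⟨s x.1 * gen x.2 * (s (x.1 * (gen x.2 : G ⧸ H)))⁻¹,
      (QuotientGroup.eq_one_iff _).1 (by simp [hs])⟩
  | .inr j => genH j

variable (J) in
/-- The word of Schreier generators obtained from a word over the generators of `G`, read from
a given coset. -/
def schreierPath (gen : ι → G) : G ⧸ H → List ι → List (Option ((G ⧸ H) × ι) ⊕ J)
  | _, [] => []
  | q, a :: w => .inl (some (q, a)) :: schreierPath gen (q * (gen a : G ⧸ H)) w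

theorem prod_schreierPath (gen : ι → G) (s : G ⧸ H → G) (hs : ∀ q, (s q : G ⧸ H) = q)
    (genH : J → H) (q : G ⧸ H) (w : List ι) :
    (((schreierPath J gen q w).map (schreierGen gen s hs genH)).prod : G) =
      s q * (w.map gen).prod * (s (q * ((w.map gen).prod : G)))⁻¹ := by
  induction w generalizing q with
  | nil => simp [schreierPath]
  | cons a w ih =>
    simp only [schreierPath, List.map_cons, List.prod_cons, Subgroup.coe_mul, ih, schreierGen,
      QuotientGroup.mk_mul]
    rw [← mul_assoc q]
    group

open Classical in
variable (J) in
/-- The automaton recognising the words of Schreier generators that come from words accepted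
by `M` whose value lies in the coset `r`. -/
noncomputable def schreierDFA (gen : ι → G) (M : DFA ι σ) (r : G ⧸ H) :
    DFA (Option ((G ⧸ H) × ι) ⊕ J) (Option (Option (σ × (G ⧸ H)))) where
  step
    | some none, .inl none => some (some (M.start, 1))
    | some (some z), .inl (some x) =>
      if z.2 = x.1 then some (some (M.step z.1 x.2, x.1 * (gen x.2 : G ⧸ H))) else none
    | _, _ => none
  start := some none
  accept := {z | ∃ y ∈ M.accept, z = some (some (y, r))}

theorem schreierDFA_evalFrom_none (gen : ι → G) (M : DFA ι σ) (r : G ⧸ H) (w) :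
    (schreierDFA J gen M r).evalFrom none w = none := by
  induction w with
  | nil => rfl
  | cons a w ih => simpa [schreierDFA] using ih

theorem schreierDFA_evalFrom (gen : ι → G) (M : DFA ι σ) (r : G ⧸ H) (z : σ) (q : G ⧸ H) (v) :
    (schreierDFA J gen M r).evalFrom (some (some (z, q))) v ∈ (schreierDFA J gen M r).accept ↔
      ∃ w, M.evalFrom z w ∈ M.accept ∧ q * ((w.map gen).prod : G) = r ∧
        v = schreierPath J gen q w := by
  have hnone : (none : Option (Option (σ × (G ⧸ H)))) ∉ (schreierDFA J gen M r).accept := by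
    simp [schreierDFA]
  induction v generalizing z q with
  | nil =>
    constructor
    · rintro ⟨y, hy, h⟩
      simp at h
      exact ⟨[], by simpa [h] using hy, by simp [h], rfl⟩
    · rintro ⟨_ | ⟨a, w⟩, h₁, h₂, h₃⟩
      · exact ⟨z, h₁, by simpa using h₂⟩
      · simp [schreierPath] at h₃
  | cons x v ih =>
    rw [DFA.evalFrom_cons]
    by_cases hx : ∃ a, x = .inl (some (q, a))
    · obtain ⟨a, rfl⟩ := hx
      have : (schreierDFA J gen M r).step (some (some (z, q))) (.inl (some (q, a))) =
          some (some (M.step z a, q * (gen a : G ⧸ H))) := by simp [schreierDFA]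
      rw [this]
      refine (ih _ _).trans ?_
      constructor
      · rintro ⟨w, h₁, h₂, rfl⟩
        exact ⟨a :: w, h₁, by simpa [mul_assoc] using h₂, rfl⟩
      · rintro ⟨_ | ⟨b, w⟩, h₁, h₂, h₃⟩
        · simp [schreierPath] at h₃
        · simp only [schreierPath, List.cons.injEq, Sum.inl.injEq, Option.some.injEq,
            Prod.mk.injEq, true_and] at h₃
          obtain ⟨rfl, rfl⟩ := h₃
          exact ⟨w, h₁, by simpa [mul_assoc] using h₂, rfl⟩
    · have : (schreierDFA J gen M r).step (some (some (z, q))) x = none := by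
        rcases x with (_ | ⟨q', a⟩) | j
        · rfl
        · have : q ≠ q' := by rintro rfl; exact hx ⟨a, rfl⟩
          simp [schreierDFA, this]
        · rfl
      rw [this, schreierDFA_evalFrom_none]
      refine iff_of_false hnone ?_
      rintro ⟨_ | ⟨b, w⟩, h₁, h₂, h₃⟩
      · simp [schreierPath] at h₃
      · simp only [schreierPath, List.cons.injEq] at h₃
        exact hx ⟨b, h₃.1⟩

theorem mem_accepts_schreierDFA (gen : ι → G) (M : DFA ι σ) (r : G ⧸ H) (v) :
    v ∈ (schreierDFA J gen M r).accepts ↔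
      ∃ w ∈ M.accepts, (((w.map gen).prod : G) : G ⧸ H) = r ∧
        v = .inl none :: schreierPath J gen 1 w := by
  rw [DFA.mem_accepts]
  rcases v with _ | ⟨x, v⟩
  · simp [DFA.eval, schreierDFA]
  by_cases hx : x = .inl none
  · subst hx
    have := schreierDFA_evalFrom (J := J) gen M r M.start 1 v
    rw [DFA.eval, DFA.evalFrom_cons]
    refine Iff.trans this ?_
    simp [DFA.mem_accepts, DFA.eval]
  · have : (schreierDFA J gen M r).step (some none) x = none := by
      rcases x with (_ | x) | j
      · exact (hx rfl).elim
      · rfl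
      · rfl
    rw [DFA.eval, DFA.evalFrom_cons]
    change (schreierDFA J gen M r).evalFrom ((schreierDFA J gen M r).step (some none) x) v ∈ _ ↔ _
    rw [this, schreierDFA_evalFrom_none]
    simp [schreierDFA, hx]

/-- The intersection of a translate of a rational subset with a finitely generated normal
subgroup of finite index is rational in the subgroup. -/
theorem IsRationalSubset.preimage_mul [H.FiniteIndex] [Finite J] {genH : J → H}
    (hgenH : Subgroup.closure (Set.range genH) = ⊤) {A : Set G} (hA : IsRationalSubset A)
    (t : G) : IsRationalSubset {h : H | (h : G) * t ∈ A} := by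
  classical
  obtain ⟨ι, _, gen, L, -, ⟨σ, _, M, rfl⟩, rfl⟩ := hA
  let s : G ⧸ H → G := Function.update Quotient.out (t : G ⧸ H) t
  have hs : ∀ q, (s q : G ⧸ H) = q := by
    intro q
    by_cases hq : q = (t : G ⧸ H)
    · subst hq; simp [s]
    · simp [s, hq]
  have hst : s (t : G ⧸ H) = t := by simp [s]
  let genS : J × Bool → H := fun l => if l.2 then genH l.1 else (genH l.1)⁻¹
  refine ⟨Option ((G ⧸ H) × ι) ⊕ (J × Bool), Fintype.ofFinite _, schreierGen gen s hs genS,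
    (schreierDFA (J × Bool) gen M (t : G ⧸ H)).accepts, ?_, ⟨_, Fintype.ofFinite _, _, rfl⟩, ?_⟩
  · rw [eq_top_iff, ← Subgroup.top_toSubmonoid, ← hgenH, Subgroup.closure_toSubmonoid]
    refine Submonoid.closure_mono ?_
    rintro x (⟨j, rfl⟩ | ⟨j, hj⟩)
    · exact ⟨.inr (j, true), rfl⟩
    · exact ⟨.inr (j, false), by simp [schreierGen, genS, hj]⟩
  · have key : ∀ w : List ι, (((w.map gen).prod : G) : G ⧸ H) = t →
        (((Sum.inl none :: schreierPath (J × Bool) gen 1 w).map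
          (schreierGen gen s hs genS)).prod : G) = (w.map gen).prod * t⁻¹ := by
      intro w hw
      rw [List.map_cons, List.prod_cons, Subgroup.coe_mul, prod_schreierPath, one_mul, hw, hst]
      simp [schreierGen, mul_assoc]
    ext h
    constructor
    · rintro ⟨w, hw, h'⟩
      have hw' : (((w.map gen).prod : G) : G ⧸ H) = t := by
        simp only at h'
        rw [h', QuotientGroup.mk_mul, (QuotientGroup.eq_one_iff _).2 h.2, one_mul]
      refine ⟨_, (mem_accepts_schreierDFA _ _ _ _).2 ⟨w, hw, hw', rfl⟩, Subtype.ext ?_⟩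
      simp only at h'
      rw [key w hw', h', mul_inv_cancel_right]
    · rintro ⟨v, hv, rfl⟩
      obtain ⟨w, hw, hw', rfl⟩ := (mem_accepts_schreierDFA _ _ _ _).1 hv
      refine ⟨w, hw, ?_⟩
      simp only
      rw [key w hw', inv_mul_cancel_right]

end Rational
/-- Let `H` be a finite index normal subgroup of `G`, `Ω` the group of
automorphisms of `H` induced by conjugation by elements of `G`, `η_H` a normal form for
`(H, Σ_H)`, `T = range rep` a right transversal, and `η` the inherited normal form on `G`
over `Σ_H ⊔ T`, `η(g) = η_H(h_g)·t_g`. If every finite system of `Ω`-twisted equations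
with rational constraints in `H` has EDT0L solution language w.r.t. `η_H`, then every
finite system of equations with rational constraints in `G` has EDT0L solution language
w.r.t. `η`. -/
theorem edt0l_in_finite_extension {G : Type} [Group G]
    (H : Subgroup G) [H.Normal] [H.FiniteIndex]
    {ιH : Type} [Fintype ιH] (genH : ιH → H)
    (hgenH : Subgroup.closure (Set.range genH) = ⊤)
    (ηH : H → List (ιH × Bool)) (hηH : ∀ h : H, evalWord genH (ηH h) = h)
    (rep : G → G)
    (hrep1 : ∀ g : G, g * (rep g)⁻¹ ∈ H)
    (hrep2 : ∀ g g' : G, g * g'⁻¹ ∈ H → rep g = rep g')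
    (η : G → List ((ιH ⊕ ↥(Set.range rep)) × Bool))
    (hη : ∀ g : G, η g =
      ((ηH ⟨g * (rep g)⁻¹, hrep1 g⟩).map fun l => (Sum.inl l.1, l.2)) ++
        [(Sum.inr ⟨rep g, Set.mem_range_self g⟩, true)])
    (hHtwisted : ∀ (m : ℕ)
      (TE : Set (List ((↥H) ⊕ (FreeGroup (Fin m) × ↥(MulAut.conjNormal (H := H)).range))))
      (TC : Fin m → Set ↥H), TE.Finite → (∀ i, IsRationalSubset (TC i)) →
      IsEDT0L (twistedSolutionLanguage (MulAut.conjNormal (H := H)).range ηH TE TC)) :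
    ∀ (m : ℕ) (E : Set (Monoid.Coprod G (FreeGroup (Fin m)))) (Rc : Fin m → Set G),
      E.Finite → (∀ i, IsRationalSubset (Rc i)) →
      IsEDT0L (solutionLanguageC η E Rc) := by
  intro m E Rc hE hRc
  have hrep3 : ∀ (h : H) (t : Set.range rep), rep (h * t) = t := by
    rintro h ⟨_, g, rfl⟩
    refine hrep2 _ _ ?_
    have := H.mul_mem h.2 (H.inv_mem (hrep1 g))
    simpa [mul_assoc] using this
  have hfin : Finite (Set.range rep) := by
    refine (Set.finite_range fun q : G ⧸ H => rep q.out).subset ?_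
    rintro _ ⟨g, rfl⟩
    exact ⟨g, hrep2 _ _ ((QuotientGroup.eq_one_iff _).1 (by simp))⟩
  let val (t : Fin m → Set.range rep) : Monoid.Coprod G (FreeGroup (Fin m)) →* G :=
    Monoid.Coprod.lift (MonoidHom.id G) (FreeGroup.lift fun i => (t i : G))
  choose W hW using fun (t : Fin m → Set.range rep) =>
    hasTwistedForm (H := H) (fun i => (t i : G))
  let κ := {t : Fin m → Set.range rep // ∀ e ∈ E, val t e ∈ H}
  let TE (k : κ) := Set.range fun e : E => W k.1 e ++ [.inl ⟨val k.1 e, k.2 e e.2⟩]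
  let TC (k : κ) (i : Fin m) : Set H := {h | (h : G) * k.1 i ∈ Rc i}
  have hL : ∀ k : κ, IsEDT0L (twistedSolutionLanguage _ ηH (TE k) (TC k)) := fun k =>
    have := hE.to_subtype
    hHtwisted m _ _ (Set.finite_range _) fun i => (hRc i).preimage_mul hgenH _
  have hsol : ∀ (k : κ) (h : Fin m → H), (∀ e ∈ TE k, twistedEval _ h e = 1) ↔
      SolvesSystem E fun i => (h i : G) * k.1 i := by
    intro k h
    simp only [TE, Set.forall_mem_range, Subtype.forall, SolvesSystem]
    refine forall₂_congr fun e he => ?_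
    rw [hW, twistedEval_append, ← OneMemClass.coe_eq_one]
    simp [twistedEval, val]
  have hηmul : ∀ (h : H) (t : Set.range rep), η (h * t) =
      (ηH h).map (fun l => (Sum.inl l.1, l.2)) ++ [(Sum.inr t, true)] := by
    intro h t
    have h₁ : (⟨h * t * (rep (h * t))⁻¹, hrep1 _⟩ : H) = h :=
      Subtype.ext <| by
        change (h : G) * t * (rep (h * t))⁻¹ = h
        rw [hrep3, mul_inv_cancel_right]
    have h₂ : (⟨rep (h * t), Set.mem_range_self _⟩ : Set.range rep) = t :=
      Subtype.ext (hrep3 h t)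
    rw [hη, h₁, h₂]
  let T (k : κ) (q : Fin (m + 1)) : (ιH ⊕ Set.range rep) × Bool :=
    (.inr (if hq : (q : ℕ) < m then k.1 ⟨q, hq⟩ else ⟨rep 1, Set.mem_range_self 1⟩), true)
  have hiter : ∀ i ≤ m, ((((· + 1)^[i] (0 : Fin (m + 1))) : Fin (m + 1)) : ℕ) = i := by
    intro i
    induction i with
    | zero => simp
    | succ i ih =>
      intro hi
      rw [Function.iterate_succ_apply', Fin.val_add_one_of_lt', ih (by omega)]
      rw [ih (by omega)]
      omega
  have hT : ∀ (k : κ) (i : Fin m), T k ((· + 1)^[(i : ℕ)] 0) = (.inr (k.1 i), true) := by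
    intro k i
    have := hiter i i.2.le
    generalize ((· + 1)^[(i : ℕ)] (0 : Fin (m + 1))) = q at this ⊢
    simp [T, this]
  choose u hu using fun k : κ => exists_transduce_hashWord
    (fun l : ιH × Bool => ((Sum.inl l.1 : ιH ⊕ Set.range rep), l.2)) (T k) (· + 1) m 0
  have huη : ∀ (k : κ) (h : Fin m → H), transduce (hashStep (· + 1))
      (hashOutput (fun l : ιH × Bool => ((Sum.inl l.1 : ιH ⊕ Set.range rep), l.2)) (T k)) 0
      (hashWord fun i => ηH (h i)) ++ u k = hashWord fun i => η (h i * k.1 i) := by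
    intro k h
    simp only [hu, hT, hηmul]
  have hunion := isEDT0L_iUnion_transduce hL (hashStep (· + 1)) (fun k =>
    hashOutput (fun l : ιH × Bool => ((Sum.inl l.1 : ιH ⊕ Set.range rep), l.2)) (T k)) 0 u
  refine (congrArg IsEDT0L (Set.ext fun w => ?_)).mpr hunion
  constructor
  · rintro ⟨g, hg, hgR, rfl⟩
    obtain ⟨t, h, rfl⟩ : ∃ (t : Fin m → Set.range rep) (h : Fin m → H),
        (fun i => (h i : G) * t i) = g :=
      ⟨fun i => ⟨rep (g i), Set.mem_range_self _⟩, fun i => ⟨_, hrep1 (g i)⟩,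
        funext fun i => inv_mul_cancel_right _ _⟩
    have ht : ∀ e ∈ E, val t e ∈ H := by
      intro e he
      have := hg e he
      rw [hW] at this
      rw [← inv_eq_of_mul_eq_one_right this]
      exact H.inv_mem (SetLike.coe_mem _)
    exact ⟨⟨t, ht⟩, _, ⟨h, (hsol ⟨t, ht⟩ h).2 hg, hgR, rfl⟩, (huη ⟨t, ht⟩ h).symm⟩
  · rintro ⟨k, _, ⟨h, hs, hc, rfl⟩, rfl⟩
    exact ⟨_, (hsol k h).1 hs, hc, huη k h⟩

end Paper
end

section
/- Let H be a finitely generated group with finite generating set Σ_H and normal form η_H such that the solution language of every finite system of equations in H with respect to η_H is EDT0L. Let K be a finite group acting on a finite set A, and let H ≀ K = (∏_{a ∈ A} H) ⋊ K denote the wreath product, where K acts by permuting the coordinates of the direct product. Then there is a finite generating set and normal form η for H ≀ K such that the solution language of every finite system of equations in H ≀ K with respect to η is EDT0L; moreover, if η_H is regular then η is regular, and if η_H is quasigeodesic then η is quasigeodesic. -/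
namespace Paper

/-- The automorphism of `∏_{a ∈ A} H` given by permuting coordinates by the action of
`k : K`. -/
def coordAut {A H K : Type} [Group H] [Group K] [MulAction K A] (k : K) :
    MulAut (A → H) where
  toFun := fun f a => f (k⁻¹ • a)
  invFun := fun f a => f (k • a)
  left_inv := fun f => funext fun a => by simp
  right_inv := fun f => funext fun a => by simp
  map_mul' := fun f g => rfl

/-- The action homomorphism `K →* Aut(∏_{a ∈ A} H)` permuting the coordinates. -/
def wreathHom (A H K : Type) [Group H] [Group K] [MulAction K A] :
    K →* MulAut (A → H) where
  toFun := coordAut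
  map_one' := MulEquiv.ext fun f => funext fun a => by simp [coordAut]
  map_mul' := fun k₁ k₂ => MulEquiv.ext fun f => funext fun a => by
    simp [coordAut, MulAut.mul_apply, mul_smul]

/-- The wreath product `H ≀ K = (∏_{a ∈ A} H) ⋊ K`, where the finite group `K` acts on
the finite set `A` and permutes the coordinates of the direct power. -/
abbrev WreathProd (A H K : Type) [Group H] [Group K] [MulAction K A] : Type :=
  SemidirectProduct (A → H) K (wreathHom A H K)

/-- A nondeterministic presentation of an EDT0L language: words over `C` are rewritten along
the edges of a finite graph with vertex set `V`, beginning at one of finitely many initial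
words and ending with one of finitely many partial homomorphisms to `β*` (the value `none`
marks an undefined letter). -/
structure RewriteGraph (β : Type) where
  C : Type
  V : Type
  I : Type
  E : Type
  F : Type
  finC : Finite C
  finV : Finite V
  finI : Finite I
  finE : Finite E
  finF : Finite F
  initV : I → V
  initW : I → List C
  src : E → V
  tgt : E → V
  sub : E → C → List C
  finalV : F → V
  finalMap : F → C → List (Option β)

namespace RewriteGraph

/-- `G.Yields v u w` means that the word `u` at the vertex `v` can be rewritten to `w`. -/
inductive Yields {β : Type} (G : RewriteGraph β) : G.V → List G.C → List β → Prop
  | final (f : G.F) (u : List G.C) (w : List β)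
      (h : u.flatMap (G.finalMap f) = w.map some) : Yields G (G.finalV f) u w
  | edge (e : G.E) (u : List G.C) (w : List β)
      (h : Yields G (G.tgt e) (subApply (G.sub e) u) w) : Yields G (G.src e) u w

/-- The language presented by a rewrite graph. -/
def language {β : Type} (G : RewriteGraph β) : Language β :=
  {w | ∃ i, G.Yields (G.initV i) (G.initW i) w}

end RewriteGraph

theorem map_eq_flatMap_singleton {γ δ : Type*} (f : γ → δ) (l : List γ) :
    l.map f = l.flatMap fun x => [f x] := by
  induction l <;> simp_all

theorem subApply_eq_flatMap {C : Type*} (f : C → List C) (w : List C) :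
    subApply f w = w.flatMap f := rfl

/-! ### EDT0L languages are presented by rewrite graphs -/

/-- The rewrite graph of an EDT0L system whose control is accepted by the automaton `M`. -/
def graphOfSystem {β : Type} (S : EDT0LSystem β) {σ : Type} [Finite σ] (M : DFA S.ι σ) :
    RewriteGraph β where
  C := S.C
  V := σ
  I := Unit
  E := σ × S.ι
  F := {s // s ∈ M.accept}
  finC := have := S.finC; inferInstance
  finV := inferInstance
  finI := inferInstance
  finE := have := S.finι; inferInstance
  finF := inferInstance
  initV := fun _ => M.start
  initW := fun _ => S.start
  src := fun e => e.1
  tgt := fun e => M.step e.1 e.2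
  sub := fun e => S.tab e.2
  finalV := fun s => s.1
  finalMap := fun _ c => [S.term c]

theorem graphOfSystem_yields_iff {β : Type} (S : EDT0LSystem β) {σ : Type} [Finite σ]
    (M : DFA S.ι σ) (s : (graphOfSystem S M).V) (u : List (graphOfSystem S M).C) (w : List β) :
    (graphOfSystem S M).Yields s u w ↔
      ∃ φs, M.evalFrom s φs ∈ M.accept ∧ (S.apply φs u).map S.term = w.map some := by
  constructor
  · intro h
    induction h with
    | final f u w h =>
      refine ⟨[], f.2, ?_⟩
      rw [← h]
      exact map_eq_flatMap_singleton _ _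
    | edge e u w _ ih =>
      obtain ⟨φs, h₁, h₂⟩ := ih
      exact ⟨e.2 :: φs, h₁, h₂⟩
  · rintro ⟨φs, h₁, h₂⟩
    induction φs generalizing s u with
    | nil =>
      refine RewriteGraph.Yields.final (G := graphOfSystem S M) ⟨s, h₁⟩ u w ?_
      rw [← h₂]
      exact (map_eq_flatMap_singleton _ _).symm
    | cons i φs ih =>
      exact RewriteGraph.Yields.edge (G := graphOfSystem S M) (s, i) u w (ih _ _ h₁ h₂)

theorem IsEDT0L.exists_rewriteGraph {β : Type} {L : Language β} (h : IsEDT0L L) :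
    ∃ G : RewriteGraph β, G.language = L := by
  obtain ⟨S, rfl⟩ := h
  obtain ⟨σ, _, M, hM⟩ := S.control_reg
  refine ⟨graphOfSystem S M, ?_⟩
  ext w
  have key := graphOfSystem_yields_iff S M M.start S.start w
  constructor
  · rintro ⟨_, h⟩
    obtain ⟨φs, h₁, h₂⟩ := key.1 h
    exact ⟨φs, hM ▸ h₁, h₂⟩
  · rintro ⟨φs, h₁, h₂⟩
    rw [← hM] at h₁
    exact ⟨(), key.2 ⟨φs, h₁, h₂⟩⟩

/-! ### Rewrite graphs present EDT0L languages -/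

/-- The states of the control automaton associated with a rewrite graph with vertices `V`. -/
inductive ControlState (V : Type)
  | start
  | run (v : V)
  | done
  | dead

theorem ControlState.finite (V : Type) [Finite V] : Finite (ControlState V) := by
  refine Finite.of_surjective
    (fun x : Option (Option (Option V)) => match x with
      | none => ControlState.start
      | some none => ControlState.done
      | some (some none) => ControlState.dead
      | some (some (some v)) => ControlState.run v) ?_
  rintro (_ | v | _ | _)
  exacts [⟨none, rfl⟩, ⟨some (some (some v)), rfl⟩, ⟨some none, rfl⟩, ⟨some (some none), rfl⟩]

namespace RewriteGraph

variable {β : Type} (G : RewriteGraph β)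

open Classical in
/-- The control automaton of a rewrite graph: it reads an initial index, then the edges of a
path, then a final index. -/
noncomputable def controlDFA : DFA (G.I ⊕ G.E ⊕ G.F) (ControlState G.V) where
  step := fun s x => match s, x with
    | .start, .inl i => .run (G.initV i)
    | .run v, .inr (.inl e) => if v = G.src e then .run (G.tgt e) else .dead
    | .run v, .inr (.inr f) => if v = G.finalV f then .done else .dead
    | _, _ => .dead
  start := .start
  accept := {.done}

/-- The table of substitutions of the EDT0L system of a rewrite graph. The letter `none` is
the start letter; it also serves as the undefined letter. -/
def systemTab : G.I ⊕ G.E ⊕ G.F → Option (G.C ⊕ β) → List (Option (G.C ⊕ β))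
  | .inl i, none => (G.initW i).map fun c => some (.inl c)
  | .inr (.inl e), some (.inl c) => (G.sub e c).map fun c => some (.inl c)
  | .inr (.inr f), some (.inl c) => (G.finalMap f c).map (Option.map Sum.inr)
  | _, _ => []

/-- The action of a word over the indices of a rewrite graph by substitutions. -/
def applyTab (φs : List (G.I ⊕ G.E ⊕ G.F)) (w : List (Option (G.C ⊕ β))) :
    List (Option (G.C ⊕ β)) :=
  φs.foldl (fun v i => subApply (G.systemTab i) v) w

theorem applyTab_cons (x : G.I ⊕ G.E ⊕ G.F) (φs : List (G.I ⊕ G.E ⊕ G.F))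
    (w : List (Option (G.C ⊕ β))) :
    G.applyTab (x :: φs) w = G.applyTab φs (subApply (G.systemTab x) w) := rfl

/-- The terminal letters of the EDT0L system of a rewrite graph. -/
def systemTerm : Option (G.C ⊕ β) → Option β
  | some (.inr b) => some b
  | _ => none

/-- The EDT0L system of a rewrite graph. -/
noncomputable def toSystem [Finite β] : EDT0LSystem β where
  C := Option (G.C ⊕ β)
  finC := have := G.finC; Fintype.ofFinite _
  term := G.systemTerm
  term_inj := by
    rintro (_ | _ | b) (_ | _ | b') a h h' <;> simp_all [systemTerm]
  start := [none]
  ι := G.I ⊕ G.E ⊕ G.F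
  finι := have := G.finI; have := G.finE; have := G.finF; Fintype.ofFinite _
  tab := G.systemTab
  control := G.controlDFA.accepts
  control_reg := by
    have := G.finV
    have := ControlState.finite G.V
    exact ⟨_, Fintype.ofFinite _, G.controlDFA, rfl⟩

theorem controlDFA_evalFrom_dead (φs : List (G.I ⊕ G.E ⊕ G.F)) :
    G.controlDFA.evalFrom .dead φs = .dead := by
  induction φs with
  | nil => rfl
  | cons x φs ih => exact ih

theorem controlDFA_evalFrom_done {φs : List (G.I ⊕ G.E ⊕ G.F)}
    (h : G.controlDFA.evalFrom .done φs = .done) : φs = [] := by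
  cases φs with
  | nil => rfl
  | cons x φs =>
    have : G.controlDFA.evalFrom .dead φs = .done := h
    simp [controlDFA_evalFrom_dead] at this

theorem subApply_systemTab_edge (e : G.E) (u : List G.C) :
    subApply (G.systemTab (.inr (.inl e))) (u.map fun c => some (.inl c)) =
      (subApply (G.sub e) u).map fun c => some (.inl c) := by
  simp [subApply_eq_flatMap, List.flatMap_map, List.map_flatMap, systemTab]

theorem map_term_systemTab_final (f : G.F) (u : List G.C) :
    (subApply (G.systemTab (.inr (.inr f))) (u.map fun c => some (.inl c))).map G.systemTerm =
      u.flatMap (G.finalMap f) := by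
  have h : G.systemTerm ∘ Option.map Sum.inr = id := by
    funext x
    cases x <;> rfl
  simp [subApply_eq_flatMap, List.flatMap_map, List.map_flatMap, systemTab, h]

theorem subApply_systemTab_start (i : G.I) :
    subApply (G.systemTab (.inl i)) [none] = (G.initW i).map fun c => some (.inl c) := by
  simp [subApply_eq_flatMap, systemTab]

theorem yields_iff_applyTab (v : G.V) (u : List G.C) (w : List β) :
    G.Yields v u w ↔ ∃ φs, G.controlDFA.evalFrom (.run v) φs = .done ∧
      (G.applyTab φs (u.map fun c => some (.inl c))).map G.systemTerm = w.map some := by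
  constructor
  · intro h
    induction h with
    | final f u w h =>
      refine ⟨[.inr (.inr f)], by simp [controlDFA], ?_⟩
      rw [← h]
      exact G.map_term_systemTab_final f u
    | edge e u w _ ih =>
      obtain ⟨φs, h₁, h₂⟩ := ih
      refine ⟨.inr (.inl e) :: φs, by simpa [controlDFA] using h₁, ?_⟩
      rwa [applyTab_cons, subApply_systemTab_edge]
  · rintro ⟨φs, h₁, h₂⟩
    induction φs generalizing v u with
    | nil => simp at h₁
    | cons x φs ih =>
      rcases x with i | e | f
      · have : G.controlDFA.evalFrom .dead φs = .done := h₁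
        simp [controlDFA_evalFrom_dead] at this
      · by_cases hv : v = G.src e
        · subst hv
          refine .edge e u w (ih _ _ (by simpa [controlDFA] using h₁) ?_)
          rwa [applyTab_cons, subApply_systemTab_edge] at h₂
        · have : G.controlDFA.evalFrom .dead φs = .done := by
            simpa [controlDFA, hv] using h₁
          simp [controlDFA_evalFrom_dead] at this
      · by_cases hv : v = G.finalV f
        · subst hv
          have : G.controlDFA.evalFrom .done φs = .done := by simpa [controlDFA] using h₁
          obtain rfl := G.controlDFA_evalFrom_done this
          refine .final f u w ?_
          rw [← h₂]
          exact (G.map_term_systemTab_final f u).symm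
        · have : G.controlDFA.evalFrom .dead φs = .done := by
            simpa [controlDFA, hv] using h₁
          simp [controlDFA_evalFrom_dead] at this

theorem isEDT0L_language [Finite β] : IsEDT0L G.language := by
  refine ⟨G.toSystem, ?_⟩
  ext w
  have key : w ∈ G.toSystem.accepts ↔ ∃ φs, G.controlDFA.evalFrom .start φs = .done ∧
      (G.applyTab φs [none]).map G.systemTerm = w.map some := Iff.rfl
  rw [key]
  constructor
  · rintro ⟨φs, h₁, h₂⟩
    rcases φs with _ | ⟨i | x, φs⟩
    · simp at h₁
    · rw [applyTab_cons, subApply_systemTab_start] at h₂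
      exact ⟨i, (G.yields_iff_applyTab _ _ _).2 ⟨φs, h₁, h₂⟩⟩
    · have : G.controlDFA.evalFrom .dead φs = .done := h₁
      simp [controlDFA_evalFrom_dead] at this
  · rintro ⟨i, h⟩
    obtain ⟨φs, h₁, h₂⟩ := (G.yields_iff_applyTab _ _ _).1 h
    refine ⟨.inl i :: φs, h₁, ?_⟩
    rwa [applyTab_cons, subApply_systemTab_start]

end RewriteGraph

theorem isEDT0L_iff_exists_rewriteGraph {β : Type} [Finite β] {L : Language β} :
    IsEDT0L L ↔ ∃ G : RewriteGraph β, G.language = L :=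
  ⟨IsEDT0L.exists_rewriteGraph, fun ⟨G, h⟩ => h ▸ G.isEDT0L_language⟩

/-! ### Finite unions -/

namespace RewriteGraph

variable {β J : Type}

open Classical in
/-- The disjoint union of a family of rewrite graphs. -/
noncomputable def union [Finite J] (G : J → RewriteGraph β) : RewriteGraph β where
  C := Σ j, (G j).C
  V := Σ j, (G j).V
  I := Σ j, (G j).I
  E := Σ j, (G j).E
  F := Σ j, (G j).F
  finC := have := fun j => (G j).finC; inferInstance
  finV := have := fun j => (G j).finV; inferInstance
  finI := have := fun j => (G j).finI; inferInstance
  finE := have := fun j => (G j).finE; inferInstance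
  finF := have := fun j => (G j).finF; inferInstance
  initV := fun i => ⟨i.1, (G i.1).initV i.2⟩
  initW := fun i => ((G i.1).initW i.2).map (Sigma.mk i.1)
  src := fun e => ⟨e.1, (G e.1).src e.2⟩
  tgt := fun e => ⟨e.1, (G e.1).tgt e.2⟩
  sub := fun e c =>
    if h : c.1 = e.1 then ((G e.1).sub e.2 (h ▸ c.2)).map (Sigma.mk e.1) else []
  finalV := fun f => ⟨f.1, (G f.1).finalV f.2⟩
  finalMap := fun f c => if h : c.1 = f.1 then (G f.1).finalMap f.2 (h ▸ c.2) else []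

variable [Finite J] (G : J → RewriteGraph β)

theorem subApply_union (j : J) (e : (G j).E) (u : List (G j).C) :
    subApply ((union G).sub ⟨j, e⟩) (u.map (Sigma.mk j)) =
      (subApply ((G j).sub e) u).map (Sigma.mk j) := by
  simp [subApply_eq_flatMap, List.flatMap_map, List.map_flatMap, union]

theorem flatMap_finalMap_union (j : J) (f : (G j).F) (u : List (G j).C) :
    (u.map (Sigma.mk j)).flatMap ((union G).finalMap ⟨j, f⟩) = u.flatMap ((G j).finalMap f) := by
  simp [List.flatMap_map, union]

theorem Yields.union {j : J} {v : (G j).V} {u : List (G j).C} {w : List β}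
    (h : (G j).Yields v u w) : (union G).Yields ⟨j, v⟩ (u.map (Sigma.mk j)) w := by
  induction h with
  | final f u w h =>
    exact .final (G := RewriteGraph.union G) ⟨j, f⟩ _ w ((flatMap_finalMap_union G j f u).trans h)
  | edge e u w _ ih =>
    refine .edge (G := RewriteGraph.union G) ⟨j, e⟩ _ w ?_
    rw [subApply_union]
    exact ih

theorem Yields.of_union {x : (RewriteGraph.union G).V} {y : List (RewriteGraph.union G).C}
    {w : List β} (h : (RewriteGraph.union G).Yields x y w) :
    ∀ u : List (G x.1).C, y = u.map (Sigma.mk x.1) → (G x.1).Yields x.2 u w := by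
  induction h with
  | final f y w h =>
    rintro u rfl
    exact .final f.2 u w ((flatMap_finalMap_union G f.1 f.2 u).symm.trans h)
  | edge e y w _ ih =>
    rintro u rfl
    exact .edge e.2 u w (ih _ (subApply_union G e.1 e.2 u))

theorem mem_language_union {w : List β} :
    w ∈ (union G).language ↔ ∃ j, w ∈ (G j).language :=
  ⟨fun ⟨i, h⟩ => ⟨i.1, i.2, h.of_union G _ rfl⟩, fun ⟨j, i, h⟩ => ⟨⟨j, i⟩, h.union G⟩⟩

end RewriteGraph

theorem IsEDT0L.iUnion {β J : Type} [Finite β] [Finite J] {L : J → Language β}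
    (h : ∀ j, IsEDT0L (L j)) : IsEDT0L ({w | ∃ j, w ∈ L j} : Language β) := by
  choose G hG using fun j => (h j).exists_rewriteGraph
  refine isEDT0L_iff_exists_rewriteGraph.2 ⟨RewriteGraph.union G, ?_⟩
  ext w
  rw [RewriteGraph.mem_language_union]
  simp only [hG]
  rfl

/-! ### Deterministic transducers -/

/-- A deterministic transducer with states `Q`, which also writes a word upon termination. -/
structure Transducer (α β Q : Type) where
  step : Q → α → Q
  out : Q → α → List β
  fin : Q → List β

namespace Transducer

variable {α β Q : Type} (T : Transducer α β Q)

/-- The output of a transducer started at the state `q`. -/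
def run : Q → List α → List β
  | q, [] => T.fin q
  | q, a :: w => T.out q a ++ run (T.step q a) w

/-- The effect of a partial letter on the state. -/
def optStep (q : Q) (a : Option α) : Q := a.elim q (T.step q)

/-- The output along a word of partial letters, without the final output. -/
def optOut : Q → List (Option α) → List (Option β)
  | _, [] => []
  | q, none :: l => none :: optOut q l
  | q, some a :: l => (T.out q a).map some ++ optOut (T.step q a) l

theorem optOut_append (q : Q) (l l' : List (Option α)) :
    T.optOut q (l ++ l') = T.optOut q l ++ T.optOut (l.foldl T.optStep q) l' := by
  induction l generalizing q with
  | nil => rfl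
  | cons a l ih => cases a <;> simp [optOut, ih, optStep]

theorem optOut_map_some (q : Q) (w : List α) :
    T.optOut q (w.map some) ++ (T.fin ((w.map some).foldl T.optStep q)).map some =
      (T.run q w).map some := by
  induction w generalizing q with
  | nil => rfl
  | cons a w ih =>
    have := ih (T.step q a)
    simp only [List.map_cons, optOut, run, List.foldl_cons, List.append_assoc, List.map_append]
    rw [← this]
    rfl

theorem exists_map_some_of_optOut {q : Q} {l : List (Option α)} {w : List β}
    {r : List (Option β)} (h : T.optOut q l ++ r = w.map some) : ∃ x : List α, l = x.map some := by
  induction l generalizing q w with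
  | nil => exact ⟨[], rfl⟩
  | cons a l ih =>
    cases a with
    | none =>
      have : none ∈ w.map some := by rw [← h]; simp [optOut]
      simp at this
    | some a =>
      simp only [optOut, List.append_assoc] at h
      obtain ⟨w₁, w₂, -, -, h₂⟩ := List.map_eq_append_iff.1 h.symm
      obtain ⟨x, rfl⟩ := ih h₂.symm
      exact ⟨a :: x, rfl⟩

end Transducer

section StateLift

variable {C Q : Type}

/-- Annotate each letter by the state reached just before it, and mark the end of the word by
the state reached there; `τ` gives the effect of each letter on the states. -/
def stateLift (τ : C → Q → Q) (q : Q) : List C → List ((Q × C) ⊕ Q)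
  | [] => [.inr q]
  | c :: u => .inl (q, c) :: stateLift τ (τ c q) u

/-- Annotate each letter by the state reached just before it. -/
def stateAnnotate (τ : C → Q → Q) (q : Q) : List C → List ((Q × C) ⊕ Q)
  | [] => []
  | c :: u => .inl (q, c) :: stateAnnotate τ (τ c q) u

/-- The effect of a word on the states. -/
def stateRun (τ : C → Q → Q) (u : List C) (q : Q) : Q := u.foldl (fun q c => τ c q) q

/-- The substitution on annotated letters induced by a substitution. -/
def stateSub (f : C → List C) (τ : C → Q → Q) : (Q × C) ⊕ Q → List ((Q × C) ⊕ Q)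
  | .inl (q, c) => stateAnnotate τ q (f c)
  | .inr q => [.inr q]

theorem stateLift_append (τ : C → Q → Q) (q : Q) (u v : List C) :
    stateLift τ q (u ++ v) = stateAnnotate τ q u ++ stateLift τ (stateRun τ u q) v := by
  induction u generalizing q with
  | nil => rfl
  | cons c u ih => simp [stateLift, stateAnnotate, stateRun, ih]

theorem subApply_stateSub (f : C → List C) (τ : C → Q → Q) (q : Q) (u : List C) :
    subApply (stateSub f τ) (stateLift (fun c => stateRun τ (f c)) q u) =
      stateLift τ q (subApply f u) := by
  simp only [subApply_eq_flatMap]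
  induction u generalizing q with
  | nil => rfl
  | cons c u ih => simp [stateLift, stateSub, stateLift_append, ih]

end StateLift

namespace RewriteGraph

variable {α β Q : Type}

/-- The partial homomorphism on annotated letters which writes the output of a transducer. -/
def transduceFinal (G : RewriteGraph α) (T : Transducer α β Q) (f : G.F) :
    (Q × G.C) ⊕ Q → List (Option β)
  | .inl x => T.optOut x.1 (G.finalMap f x.2)
  | .inr q => (T.fin q).map some

/-- The rewrite graph presenting the image of a language under a transducer. A vertex records,
besides a vertex of the original graph, the effect on the states of the terminal word to which
each letter will finally be rewritten. -/
def transduce [Finite Q] (G : RewriteGraph α) (T : Transducer α β Q) (q₀ : Q) :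
    RewriteGraph β where
  C := (Q × G.C) ⊕ Q
  V := G.V × (G.C → Q → Q)
  I := G.I × (G.C → Q → Q)
  E := G.E × (G.C → Q → Q)
  F := G.F
  finC := have := G.finC; inferInstance
  finV := have := G.finC; have := G.finV; inferInstance
  finI := have := G.finC; have := G.finI; inferInstance
  finE := have := G.finC; have := G.finE; inferInstance
  finF := G.finF
  initV := fun i => (G.initV i.1, i.2)
  initW := fun i => stateLift i.2 q₀ (G.initW i.1)
  src := fun e => (G.src e.1, fun c => stateRun e.2 (G.sub e.1 c))
  tgt := fun e => (G.tgt e.1, e.2)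
  sub := fun e => stateSub (G.sub e.1) e.2
  finalV := fun f => (G.finalV f, fun c q => (G.finalMap f c).foldl T.optStep q)
  finalMap := G.transduceFinal T

variable (G : RewriteGraph α) (T : Transducer α β Q)

theorem flatMap_transduceFinal (f : G.F) (q : Q) (u : List G.C) :
    (stateLift (fun c q => (G.finalMap f c).foldl T.optStep q) q u).flatMap
        (G.transduceFinal T f) =
      T.optOut q (u.flatMap (G.finalMap f)) ++
        (T.fin ((u.flatMap (G.finalMap f)).foldl T.optStep q)).map some := by
  induction u generalizing q with
  | nil => simp [stateLift, transduceFinal, Transducer.optOut]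
  | cons c u ih =>
    rw [stateLift, List.flatMap_cons, ih]
    simp [Transducer.optOut_append, transduceFinal]

variable [Finite Q] (q₀ : Q)

theorem Yields.transduce {v : G.V} {u : List G.C} {w : List α} (h : G.Yields v u w) :
    ∃ τ, (G.transduce T q₀).Yields (v, τ) (stateLift τ q₀ u) (T.run q₀ w) := by
  induction h with
  | final f u w h =>
    refine ⟨_, .final (G := G.transduce T q₀) f _ _ ?_⟩
    refine (flatMap_transduceFinal G T f q₀ u).trans ?_
    rw [h, T.optOut_map_some]
  | edge e u w _ ih =>
    obtain ⟨τ, ih⟩ := ih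
    refine ⟨_, .edge (G := G.transduce T q₀) (e, τ) _ _ ?_⟩
    refine Eq.mp (congrArg (fun y => (G.transduce T q₀).Yields (G.tgt e, τ) y (T.run q₀ w)) ?_) ih
    exact (subApply_stateSub (G.sub e) τ q₀ u).symm

theorem Yields.of_transduce {x : (G.transduce T q₀).V} {y : List (G.transduce T q₀).C}
    {w : List β} (h : (G.transduce T q₀).Yields x y w) :
    ∀ u : List G.C, y = stateLift x.2 q₀ u → ∃ w', G.Yields x.1 u w' ∧ T.run q₀ w' = w := by
  induction h with
  | final f y w h =>
    rintro u rfl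
    have h := (flatMap_transduceFinal G T f q₀ u).symm.trans h
    obtain ⟨w', hw'⟩ := T.exists_map_some_of_optOut h
    refine ⟨w', .final (G := G) f u w' hw', ?_⟩
    rw [hw', T.optOut_map_some] at h
    exact List.map_injective_iff.2 (Option.some_injective _) h
  | edge e y w _ ih =>
    rintro u rfl
    obtain ⟨w', h, rfl⟩ := ih _ (subApply_stateSub (G.sub e.1) e.2 q₀ u)
    exact ⟨w', .edge e.1 u w' h, rfl⟩

theorem language_transduce : (G.transduce T q₀).language = T.run q₀ '' G.language := by
  ext w
  constructor
  · rintro ⟨i, h⟩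
    obtain ⟨w', h', rfl⟩ := h.of_transduce G T q₀ _ rfl
    exact ⟨w', ⟨i.1, h'⟩, rfl⟩
  · rintro ⟨w', ⟨i, h⟩, rfl⟩
    obtain ⟨τ, h⟩ := h.transduce G T q₀
    exact ⟨(i, τ), h⟩

end RewriteGraph

theorem IsEDT0L.transduce {α β Q : Type} [Finite β] [Finite Q] {L : Language α}
    (h : IsEDT0L L) (T : Transducer α β Q) (q₀ : Q) :
    IsEDT0L (T.run q₀ '' L : Language β) := by
  obtain ⟨G, rfl⟩ := h.exists_rewriteGraph
  exact isEDT0L_iff_exists_rewriteGraph.2 ⟨G.transduce T q₀, G.language_transduce T q₀⟩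

/-! ### Reading a tuple of words -/

section Blocks

variable {α β J : Type}

/-- The transducer reading words `w₁ # ⋯ # wₙ` whose blocks are indexed by a list `L` of
indices: letters in the block of index `j` are rewritten by `r j`, and the word `s j` is written
at the end of the block. A state is the list of indices of the remaining blocks. -/
def blockTransducer (L : List J) (r : J → α → List β) (s : J → List β) :
    Transducer (α ⊕ Unit) β {l : List J // l <:+ L} where
  step := fun q x => match x with
    | .inl _ => q
    | .inr _ => ⟨q.1.tail, (List.tail_suffix _).trans q.2⟩
  out := fun q x => match q.1.head?, x with
    | some j, .inl a => r j a
    | some j, .inr _ => s j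
    | none, _ => []
  fin := fun q => match q.1.head? with
    | some j => s j
    | none => []

theorem finite_suffixes (L : List J) : Finite {l : List J // l <:+ L} := by
  have h := List.finite_toSet L.tails
  simp only [List.mem_tails] at h
  exact h.to_subtype

theorem blockTransducer_run_map_inl_append (L : List J) (r : J → α → List β) (s : J → List β)
    (j : J) (l : List J) (h : j :: l <:+ L) (w : List α) (v : List (α ⊕ Unit)) :
    (blockTransducer L r s).run ⟨j :: l, h⟩ (w.map .inl ++ v) =
      w.flatMap (r j) ++ (blockTransducer L r s).run ⟨j :: l, h⟩ v := by
  induction w with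
  | nil => rfl
  | cons a w ih =>
    rw [List.flatMap_cons, List.append_assoc, ← ih]
    rfl

theorem blockTransducer_run (L : List J) (r : J → α → List β) (s : J → List β)
    (W : J → List α) (l : List J) (h : l <:+ L) :
    (blockTransducer L r s).run ⟨l, h⟩
        (List.intercalate [.inr ()] (l.map fun j => (W j).map .inl)) =
      l.flatMap fun j => (W j).flatMap (r j) ++ s j := by
  induction l with
  | nil => rfl
  | cons j l ih =>
    cases l with
    | nil =>
      have := blockTransducer_run_map_inl_append L r s j [] h (W j) []
      simpa [Transducer.run, blockTransducer] using this
    | cons j' l =>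
      rw [List.map_cons, List.map_cons, List.intercalate_cons_cons,
        List.append_assoc, blockTransducer_run_map_inl_append, List.flatMap_cons,
        ← ih ((List.suffix_cons j _).trans h), List.append_assoc]
      rfl

theorem hashWord_get (L : List J) (W : J → List α) :
    hashWord (fun i => W (L.get i)) =
      List.intercalate [.inr ()] (L.map fun j => (W j).map .inl) := by
  unfold hashWord
  congr 1
  conv_rhs => rw [← List.ofFn_get L, List.map_ofFn]
  rfl

/-- The separator following the block of index `i` in a word with `m` blocks. -/
def hashSep (β : Type) {m : ℕ} (i : Fin m) : List (β ⊕ Unit) :=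
  if (i : ℕ) + 1 < m then [.inr ()] else []

theorem hashWord_eq_flatMap {m : ℕ} (ws : Fin m → List β) :
    hashWord ws = (List.finRange m).flatMap fun i => (ws i).map .inl ++ hashSep β i := by
  induction m with
  | zero => rfl
  | succ m ih =>
    have h := ih fun i => ws i.succ
    rw [List.finRange_succ, List.flatMap_cons, List.flatMap_map]
    have hs : ∀ i : Fin m, hashSep β i.succ = hashSep β i := fun i => by simp [hashSep]
    simp only [hs]
    rw [← h]
    cases m with
    | zero => simp [hashWord, hashSep]
    | succ m => simp [hashWord, hashSep, List.ofFn_succ]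

end Blocks

/-! ### Concatenations of regular languages -/

section Regular

variable {α β : Type}

/-- The concatenation of the image of a language under a map of letters with a language. -/
def mapConcat (φ : α → β) (L₁ : Language α) (L₂ : Language β) : Language β :=
  {x | ∃ w ∈ L₁, ∃ v ∈ L₂, x = w.map φ ++ v}

/-- The automaton accepting `mapConcat φ M₁.accepts M₂.accepts`. -/
def mapConcatNFA {σ₁ σ₂ : Type} (φ : α → β) (M₁ : DFA α σ₁) (M₂ : DFA β σ₂) :
    NFA β (σ₁ ⊕ σ₂) where
  step := fun q b => match q with
    | .inl s => {x | (∃ a, φ a = b ∧ x = .inl (M₁.step s a)) ∨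
        (s ∈ M₁.accept ∧ x = .inr (M₂.step M₂.start b))}
    | .inr t => {.inr (M₂.step t b)}
  start := {.inl M₁.start}
  accept := {x | (∃ s, x = .inl s ∧ s ∈ M₁.accept ∧ M₂.start ∈ M₂.accept) ∨
    ∃ t, x = .inr t ∧ t ∈ M₂.accept}

variable {σ₁ σ₂ : Type} (φ : α → β) (M₁ : DFA α σ₁) (M₂ : DFA β σ₂)

theorem mapConcatNFA_acceptsFrom_inr (t : σ₂) (x : List β) :
    x ∈ (mapConcatNFA φ M₁ M₂).acceptsFrom {.inr t} ↔ x ∈ M₂.acceptsFrom t := by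
  induction x generalizing t with
  | nil => simp [NFA.mem_acceptsFrom, DFA.mem_acceptsFrom, mapConcatNFA]
  | cons b x ih =>
    rw [NFA.cons_mem_acceptsFrom, NFA.stepSet_singleton]
    exact ih (M₂.step t b)

theorem mem_acceptsFrom_iff_exists {σ : Type} (M : NFA β σ) (S : Set σ) (x : List β) :
    x ∈ M.acceptsFrom S ↔ ∃ s ∈ S, x ∈ M.acceptsFrom {s} := by
  rw [NFA.mem_acceptsFrom]
  simp only [NFA.mem_acceptsFrom, NFA.mem_evalFrom_iff_exists (S := S)]
  aesop

theorem mapConcatNFA_acceptsFrom_inl (s : σ₁) (x : List β) :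
    x ∈ (mapConcatNFA φ M₁ M₂).acceptsFrom {.inl s} ↔
      x ∈ mapConcat φ (M₁.acceptsFrom s) M₂.accepts := by
  induction x generalizing s with
  | nil =>
    simp only [NFA.nil_mem_acceptsFrom, mapConcat, mapConcatNFA]
    constructor
    · rintro ⟨_, rfl, ⟨_, ⟨⟩, h₁, h₂⟩ | ⟨_, ⟨⟩, _⟩⟩
      exact ⟨[], h₁, [], h₂, rfl⟩
    · rintro ⟨w, hw, v, hv, h⟩
      obtain ⟨h₁, rfl⟩ := List.append_eq_nil_iff.1 h.symm
      obtain rfl := List.map_eq_nil_iff.1 h₁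
      exact ⟨_, rfl, .inl ⟨s, rfl, hw, hv⟩⟩
  | cons b x ih =>
    rw [NFA.cons_mem_acceptsFrom, NFA.stepSet_singleton, mem_acceptsFrom_iff_exists]
    constructor
    · rintro ⟨_, ⟨a, rfl, rfl⟩ | ⟨hs, rfl⟩, h⟩
      · obtain ⟨w, hw, v, hv, rfl⟩ := (ih _).1 h
        exact ⟨a :: w, hw, v, hv, rfl⟩
      · exact ⟨[], hs, b :: x, (mapConcatNFA_acceptsFrom_inr φ M₁ M₂ _ x).1 h, rfl⟩
    · rintro ⟨w, hw, v, hv, h⟩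
      cases w with
      | nil =>
        obtain rfl : b :: x = v := h
        exact ⟨_, .inr ⟨hw, rfl⟩, (mapConcatNFA_acceptsFrom_inr φ M₁ M₂ _ x).2 hv⟩
      | cons a w =>
        obtain ⟨rfl, rfl⟩ := List.cons_eq_cons.1 h
        exact ⟨_, .inl ⟨a, rfl, rfl⟩, (ih _).2 ⟨w, hw, v, hv, rfl⟩⟩

end Regular

section Regular

variable {α β : Type}

theorem isRegular_mapConcat (φ : α → β) {L₁ : Language α} {L₂ : Language β}
    (h₁ : L₁.IsRegular) (h₂ : L₂.IsRegular) : (mapConcat φ L₁ L₂).IsRegular := by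
  obtain ⟨σ₁, _, M₁, rfl⟩ := h₁
  obtain ⟨σ₂, _, M₂, rfl⟩ := h₂
  classical
  refine ⟨_, Fintype.ofFinite _, (mapConcatNFA φ M₁ M₂).toDFA, ?_⟩
  rw [NFA.toDFA_correct]
  ext x
  exact mapConcatNFA_acceptsFrom_inl φ M₁ M₂ M₁.start x

open Classical in
theorem isRegular_singletons (T : Set β) :
    Language.IsRegular ({x | ∃ b ∈ T, x = [b]} : Language β) := by
  let M : DFA β (Option Bool) :=
    { step := fun s b => if s = some false ∧ b ∈ T then some true else none
      start := some false
      accept := {some true} }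
  have dead : ∀ x, M.evalFrom none x = none := fun x => by
    induction x with
    | nil => rfl
    | cons b x ih => simpa [M] using ih
  refine ⟨_, inferInstance, M, ?_⟩
  ext x
  change M.evalFrom (some false) x = some true ↔ _
  rcases x with _ | ⟨b, _ | ⟨c, x⟩⟩
  · refine ⟨fun h => by simp [M] at h, ?_⟩
    rintro ⟨b, -, h⟩
    simp at h
  · by_cases hb : b ∈ T
    · have : M.evalFrom (some false) [b] = some true := by simp [M, hb]
      exact ⟨fun _ => ⟨b, hb, rfl⟩, fun _ => this⟩
    · have : M.evalFrom (some false) [b] = none := by simp [M, hb]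
      rw [this]
      refine ⟨fun h => by simp at h, ?_⟩
      rintro ⟨c, hc, h⟩
      obtain rfl : b = c := by simpa using h
      exact absurd hc hb
  · have : M.evalFrom (some false) (b :: c :: x) = none := by
      by_cases hb : b ∈ T
      · have := dead x
        simpa [M, hb] using this
      · have := dead x
        simpa [M, hb] using this
    rw [this]
    refine ⟨fun h => by simp at h, ?_⟩
    rintro ⟨d, -, h⟩
    simp at h

end Regular

/-! ### Generators and normal forms of wreath products -/

theorem evalWord_nil {G ι : Type} [Group G] (gen : ι → G) : evalWord gen [] = 1 := rfl

theorem evalWord_cons {G ι : Type} [Group G] (gen : ι → G) (x : ι × Bool)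
    (w : List (ι × Bool)) :
    evalWord gen (x :: w) = (if x.2 then gen x.1 else (gen x.1)⁻¹) * evalWord gen w := by
  simp [evalWord]

theorem evalWord_append {G ι : Type} [Group G] (gen : ι → G) (v w : List (ι × Bool)) :
    evalWord gen (v ++ w) = evalWord gen v * evalWord gen w := by
  simp [evalWord]

theorem evalWord_mem_closure {G ι : Type} [Group G] (gen : ι → G) (w : List (ι × Bool)) :
    evalWord gen w ∈ Subgroup.closure (Set.range gen) := by
  refine Subgroup.list_prod_mem _ fun x hx => ?_
  obtain ⟨⟨i, b⟩, -, rfl⟩ := List.mem_map.1 hx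
  have h : gen i ∈ Subgroup.closure (Set.range gen) :=
    Subgroup.subset_closure (Set.mem_range_self i)
  cases b
  · exact inv_mem h
  · exact h

theorem wordLength_le {G ι : Type} [Group G] (gen : ι → G) (w : List (ι × Bool)) :
    wordLength gen (evalWord gen w) ≤ w.length :=
  Nat.sInf_le ⟨w, rfl, rfl⟩

theorem exists_evalWord_length_eq {G ι : Type} [Group G] (gen : ι → G) {g : G}
    (h : ∃ w, evalWord gen w = g) : ∃ w, evalWord gen w = g ∧ w.length = wordLength gen g := by
  obtain ⟨w, hw⟩ := h
  exact Nat.sInf_mem (s := {n | ∃ w, evalWord gen w = g ∧ w.length = n}) ⟨_, w, hw, rfl⟩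

section Wreath

variable {A H K ι : Type} [Group H] [Group K] [MulAction K A]

/-- The relabelling of generators of `H` as generators of the copy of `H` at `a`. -/
def coordLetter (K : Type) (a : A) (x : ι × Bool) : ((A × ι) ⊕ K) × Bool :=
  (.inl (a, x.1), x.2)

open Classical in
/-- The generators of the wreath product: those of each copy of `H`, and all of `K`. -/
noncomputable def wreathGen (genH : ι → H) : (A × ι) ⊕ K → WreathProd A H K
  | .inl p => SemidirectProduct.inl (Pi.mulSingle p.1 (genH p.2))
  | .inr k => SemidirectProduct.inr k

/-- The normal form of a wreath product which concatenates the normal forms of the coordinates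
in the order of the list `as` and then the letter of the element of `K`. -/
def wreathNF (η : H → List (ι × Bool)) (as : List A) (w : WreathProd A H K) :
    List (((A × ι) ⊕ K) × Bool) :=
  (as.flatMap fun a => (η (w.left a)).map (coordLetter K a)) ++ [(.inr w.right, true)]

open Classical in
theorem evalWord_map_coordLetter (genH : ι → H) (a : A) (w : List (ι × Bool)) :
    evalWord (wreathGen (K := K) genH) (w.map (coordLetter K a)) =
      SemidirectProduct.inl (Pi.mulSingle a (evalWord genH w)) := by
  induction w with
  | nil => simp [evalWord_nil]
  | cons x w ih =>
    rw [List.map_cons, evalWord_cons, ih, evalWord_cons, Pi.mulSingle_mul, map_mul]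
    congr 1
    obtain ⟨i, b⟩ := x
    cases b <;> simp [coordLetter, wreathGen, Pi.mulSingle_inv]

open Classical in
theorem list_prod_mulSingle_apply (f : A → H) (as : List A) (has : as.Nodup) (b : A) :
    (as.map fun a => Pi.mulSingle (M := fun _ => H) a (f a)).prod b =
      if b ∈ as then f b else 1 := by
  induction as with
  | nil => simp
  | cons a as ih =>
    rw [List.nodup_cons] at has
    rw [List.map_cons, List.prod_cons, Pi.mul_apply, ih has.2]
    by_cases hb : b = a
    · subst hb
      simp [has.1]
    · simp [hb]

theorem evalWord_wreathNF (genH : ι → H) (η : H → List (ι × Bool))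
    (hη : ∀ h, evalWord genH (η h) = h) (as : List A) (has : as.Nodup) (hmem : ∀ a, a ∈ as)
    (w : WreathProd A H K) : evalWord (wreathGen genH) (wreathNF η as w) = w := by
  classical
  have key : ∀ l : List A, evalWord (wreathGen (K := K) genH)
      (l.flatMap fun a => (η (w.left a)).map (coordLetter K a)) =
      SemidirectProduct.inl
        (l.map fun a => Pi.mulSingle (M := fun _ => H) a (w.left a)).prod := by
    intro l
    induction l with
    | nil => rfl
    | cons a l ih =>
      rw [List.flatMap_cons, evalWord_append, ih, evalWord_map_coordLetter, hη, List.map_cons,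
        List.prod_cons, map_mul]
  rw [wreathNF, evalWord_append, key, evalWord_cons, evalWord_nil]
  have h : (as.map fun a => Pi.mulSingle (M := fun _ => H) a (w.left a)).prod = w.left := by
    funext b
    rw [list_prod_mulSingle_apply w.left as has b, if_pos (hmem b)]
  rw [h]
  simp [wreathGen]

/-! ### Regularity -/

theorem isRegular_range_wreathNF {η : H → List (ι × Bool)} (hη : IsRegularNF η) (as : List A)
    (has : as.Nodup) : IsRegularNF (wreathNF (K := K) η as) := by
  classical
  induction as with
  | nil =>
    have h : Set.range (wreathNF (A := A) (K := K) η []) =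
        {x | ∃ b ∈ Set.range fun k : K => ((Sum.inr k, true) : ((A × ι) ⊕ K) × Bool),
          x = [b]} := by
      ext x
      constructor
      · rintro ⟨w, rfl⟩
        exact ⟨_, ⟨w.right, rfl⟩, rfl⟩
      · rintro ⟨_, ⟨k, rfl⟩, rfl⟩
        exact ⟨⟨1, k⟩, rfl⟩
    rw [IsRegularNF, h]
    exact isRegular_singletons _
  | cons a as ih =>
    rw [List.nodup_cons] at has
    have h : Set.range (wreathNF (K := K) η (a :: as)) =
        mapConcat (coordLetter K a) (Set.range η : Language _)
          (Set.range (wreathNF (K := K) η as) : Language _) := by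
      ext x
      constructor
      · rintro ⟨w, rfl⟩
        exact ⟨_, ⟨w.left a, rfl⟩, _, ⟨w, rfl⟩, by simp [wreathNF]⟩
      · rintro ⟨_, ⟨h, rfl⟩, _, ⟨w, rfl⟩, rfl⟩
        refine ⟨⟨Function.update w.left a h, w.right⟩, ?_⟩
        have hcongr : as.flatMap (fun b =>
            (η (Function.update w.left a h b)).map (coordLetter K b)) =
            as.flatMap fun b => (η (w.left b)).map (coordLetter K b) := by
          refine List.flatMap_congr fun b hb => ?_
          rw [Function.update_of_ne]
          rintro rfl
          exact has.1 hb
        simp [wreathNF, hcongr]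
    rw [IsRegularNF, h]
    exact isRegular_mapConcat _ hη (ih has.2)

/-! ### Quasigeodesicity -/

theorem left_inr_mul (k : K) (w : WreathProd A H K) (a : A) :
    (SemidirectProduct.inr k * w : WreathProd A H K).left a = w.left (k⁻¹ • a) :=
  one_mul _

theorem exists_evalWord_left (genH : ι → H) (w : List (((A × ι) ⊕ K) × Bool)) (a : A) :
    ∃ v, evalWord genH v = (evalWord (wreathGen (K := K) genH) w).left a ∧
      v.length ≤ w.length := by
  classical
  induction w generalizing a with
  | nil => exact ⟨[], rfl, le_rfl⟩
  | cons x w ih =>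
    rw [evalWord_cons]
    obtain ⟨⟨b, i⟩ | k, s⟩ := x
    · obtain ⟨v, hv, hl⟩ := ih a
      have hleft : ((if s then wreathGen (K := K) genH (.inl (b, i)) else
          (wreathGen (K := K) genH (.inl (b, i)))⁻¹) *
            evalWord (wreathGen (K := K) genH) w).left a =
          (if a = b then (if s then genH i else (genH i)⁻¹) else 1) *
            (evalWord (wreathGen (K := K) genH) w).left a := by
        cases s <;> by_cases hab : a = b <;>
          simp [wreathGen, hab]
      rw [hleft]
      by_cases hab : a = b
      · exact ⟨(i, s) :: v, by rw [evalWord_cons, hv, if_pos hab], by simpa using hl⟩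
      · exact ⟨v, by rw [hv, if_neg hab, one_mul], hl.trans (by simp)⟩
    · cases s
      · obtain ⟨v, hv, hl⟩ := ih (k • a)
        refine ⟨v, ?_, hl.trans (by simp)⟩
        have hg : (wreathGen (A := A) (K := K) genH (.inr k))⁻¹ =
            SemidirectProduct.inr k⁻¹ := (map_inv _ k).symm
        rw [hv, if_neg Bool.false_ne_true, hg, left_inr_mul, inv_inv]
      · obtain ⟨v, hv, hl⟩ := ih (k⁻¹ • a)
        refine ⟨v, ?_, hl.trans (by simp)⟩
        rw [hv, if_pos rfl, wreathGen, left_inr_mul]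

theorem isQuasigeodesicNF_wreathNF (genH : ι → H) {η : H → List (ι × Bool)}
    (hη : IsQuasigeodesicNF genH η) (as : List A)
    (heval : ∀ w : WreathProd A H K, evalWord (wreathGen genH) (wreathNF η as w) = w) :
    IsQuasigeodesicNF (wreathGen (K := K) genH) (wreathNF η as) := by
  obtain ⟨lam, hlam, h⟩ := hη
  refine ⟨as.length * lam + 1, by positivity, fun w => ?_⟩
  set N : ℝ := ((wordLength (wreathGen (K := K) genH) w : ℕ) : ℝ)
  have hN0 : 0 ≤ N := Nat.cast_nonneg _
  have hcoord : ∀ a, ((η (w.left a)).length : ℝ) ≤ lam * N + lam := fun a => by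
    obtain ⟨x, hx, hxl⟩ := exists_evalWord_length_eq (wreathGen (K := K) genH) ⟨_, heval w⟩
    obtain ⟨v, hv, hvl⟩ := exists_evalWord_left genH x a
    have hle : wordLength genH (w.left a) ≤ wordLength (wreathGen (K := K) genH) w := by
      rw [← hxl, ← hx, ← hv]
      exact (wordLength_le genH v).trans hvl
    have hle' : (wordLength genH (w.left a) : ℝ) ≤ N := Nat.cast_le.2 hle
    refine (h _).trans ?_
    gcongr
  have hsum : ∀ l : List A,
      ((l.flatMap fun a => (η (w.left a)).map (coordLetter K a)).length : ℝ) ≤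
        l.length * (lam * N + lam) := fun l => by
    induction l with
    | nil => simp
    | cons a l ih =>
      have := hcoord a
      simp only [List.flatMap_cons, List.length_append, List.length_map, List.length_cons]
      push_cast
      linarith
  have := hsum as
  rw [wreathNF, List.length_append]
  push_cast
  simp only [List.length_singleton, Nat.cast_one]
  nlinarith

end Wreath

/-! ### Systems of equations in wreath products -/

section Systems

open Monoid.Coprod

variable {A H K : Type} [Group H] [Group K] [MulAction K A]

/-- The homomorphism of wreath products induced by a homomorphism of the base groups. -/
def wreathMap {G : Type} [Group G] (f : G →* H) : WreathProd A G K →* WreathProd A H K :=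
  SemidirectProduct.map (MonoidHom.pi fun a => f.comp (Pi.evalMonoidHom _ a)) (MonoidHom.id K)
    fun _ => rfl

theorem wreathMap_left {G : Type} [Group G] (f : G →* H) (w : WreathProd A G K) (a : A) :
    (wreathMap f w).left a = f (w.left a) := rfl

theorem wreathMap_right {G : Type} [Group G] (f : G →* H) (w : WreathProd A G K) :
    (wreathMap f w).right = w.right := rfl

/-- Evaluation of an equation at a tuple of elements. -/
def evalHom {G X : Type} [Group G] (g : X → G) : Monoid.Coprod G (FreeGroup X) →* G :=
  lift (MonoidHom.id G) (FreeGroup.lift g)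

/-- The substitution of `(x₍ᵢ,ₐ₎)ₐ kᵢ` for the variable `Xᵢ`, turning words with variables over a
wreath product into elements of a wreath product of words with variables. -/
def expandHom {m : ℕ} {X : Type} (x : Fin m → A → X) (k : Fin m → K) :
    Monoid.Coprod (WreathProd A H K) (FreeGroup (Fin m)) →*
      WreathProd A (Monoid.Coprod H (FreeGroup X)) K :=
  lift (wreathMap inl) (FreeGroup.lift fun i => ⟨fun a => inr (FreeGroup.of (x i a)), k i⟩)

theorem wreathMap_evalHom_expandHom {m : ℕ} {X : Type} (x : Fin m → A → X) (k : Fin m → K)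
    (g : X → H) (e : Monoid.Coprod (WreathProd A H K) (FreeGroup (Fin m))) :
    wreathMap (evalHom g) (expandHom x k e) =
      evalHom (fun i => (⟨fun a => g (x i a), k i⟩ : WreathProd A H K)) e := by
  have h : (wreathMap (evalHom g)).comp (expandHom x k) =
      evalHom fun i => (⟨fun a => g (x i a), k i⟩ : WreathProd A H K) := by
    refine Monoid.Coprod.hom_ext ?_ ?_
    · ext w
      · simp [expandHom, evalHom, wreathMap_left]
      · simp [expandHom, evalHom, wreathMap_right]
    · refine FreeGroup.ext_hom _ _ fun i => ?_
      refine SemidirectProduct.ext (funext fun a => ?_) ?_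
      · simp [expandHom, evalHom, wreathMap_left, -SemidirectProduct.mk_eq_inl_mul_inr]
      · simp [expandHom, evalHom, wreathMap_right]
  exact DFunLike.congr_fun h e

theorem evalHom_eq_one_iff {m : ℕ} {X : Type} (x : Fin m → A → X) (k : Fin m → K)
    (g : X → H) (e : Monoid.Coprod (WreathProd A H K) (FreeGroup (Fin m))) :
    evalHom (fun i => (⟨fun a => g (x i a), k i⟩ : WreathProd A H K)) e = 1 ↔
      (expandHom (H := H) x k e).right = 1 ∧
        ∀ a, evalHom g ((expandHom x k e).left a) = 1 := by
  rw [← wreathMap_evalHom_expandHom, SemidirectProduct.ext_iff, funext_iff]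
  exact and_comm

/-- The system of equations over the coordinate group obtained from a system over the wreath
product by fixing the `K`-components of the variables. -/
def expandSystem {m : ℕ} {X : Type} (x : Fin m → A → X) (k : Fin m → K)
    (E : Set (Monoid.Coprod (WreathProd A H K) (FreeGroup (Fin m)))) :
    Set (Monoid.Coprod H (FreeGroup X)) :=
  {e' | ∃ e ∈ E, ∃ a, e' = (expandHom x k e).left a}

theorem finite_expandSystem [Finite A] {m : ℕ} {X : Type} (x : Fin m → A → X) (k : Fin m → K)
    {E : Set (Monoid.Coprod (WreathProd A H K) (FreeGroup (Fin m)))} (hE : E.Finite) :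
    (expandSystem x k E).Finite := by
  have h : expandSystem x k E =
      ⋃ e ∈ E, Set.range fun a => (expandHom (H := H) x k e).left a := by
    ext e'
    simp [expandSystem, eq_comm]
  rw [h]
  exact hE.biUnion fun e _ => Set.finite_range _

theorem solvesSystem_wreath_iff {m n : ℕ} (x : Fin m → A → Fin n) (k : Fin m → K)
    (g : Fin n → H) (E : Set (Monoid.Coprod (WreathProd A H K) (FreeGroup (Fin m)))) :
    SolvesSystem E (fun i => (⟨fun a => g (x i a), k i⟩ : WreathProd A H K)) ↔
      (∀ e ∈ E, (expandHom (H := H) x k e).right = 1) ∧ SolvesSystem (expandSystem x k E) g := by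
  constructor
  · intro h
    refine ⟨fun e he => ((evalHom_eq_one_iff x k g e).1 (h e he)).1, ?_⟩
    rintro _ ⟨e, he, a, rfl⟩
    exact ((evalHom_eq_one_iff x k g e).1 (h e he)).2 a
  · rintro ⟨h₁, h₂⟩ e he
    exact (evalHom_eq_one_iff x k g e).2 ⟨h₁ e he, fun a => h₂ _ ⟨e, he, a, rfl⟩⟩

/-- The indices of the variables of the coordinate systems: for each variable `Xᵢ` of the original
system one index per coordinate and one dummy index marking the end of the block. -/
def blockIndices (m : ℕ) (as : List A) : List (Fin m × Option A) :=
  (List.finRange m).flatMap fun i => as.map (fun a => (i, some a)) ++ [(i, none)]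

theorem mem_blockIndices {m : ℕ} {as : List A} (hmem : ∀ a, a ∈ as) (p : Fin m × Option A) :
    p ∈ blockIndices m as := by
  obtain ⟨i, _ | a⟩ := p <;> simp [blockIndices, hmem]

theorem nodup_blockIndices (m : ℕ) {as : List A} (has : as.Nodup) :
    (blockIndices m as).Nodup := by
  rw [blockIndices, List.nodup_flatMap]
  constructor
  · intro i _
    refine List.Nodup.append (has.map fun a b h => ?_) (List.nodup_singleton _) ?_
    · simpa using h
    · simp
  · refine (List.nodup_finRange m).imp fun {i j} hij => ?_
    simp only [Function.onFun, List.disjoint_left]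
    rintro ⟨i', a⟩ h₁ h₂
    simp only [List.mem_append, List.mem_map, List.mem_singleton, Prod.mk.injEq] at h₁ h₂
    grind

variable {ι : Type}

/-- The rewriting of the letters in the blocks. -/
def blockLetter (m : ℕ) (p : Fin m × Option A) (x : ι × Bool) :
    List ((((A × ι) ⊕ K) × Bool) ⊕ Unit) :=
  match p.2 with
  | some a => [.inl (coordLetter K a x)]
  | none => []

/-- The words written at the ends of the blocks. -/
def blockEnd (ι : Type) {m : ℕ} (k : Fin m → K) (p : Fin m × Option A) :
    List ((((A × ι) ⊕ K) × Bool) ⊕ Unit) :=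
  match p.2 with
  | some _ => []
  | none => .inl (.inr (k p.1), true) :: hashSep _ p.1

theorem flatMap_blockIndices {m : ℕ} (η : H → List (ι × Bool)) (as : List A) (k : Fin m → K)
    (f : Fin m × Option A → H) :
    ((blockIndices m as).flatMap fun p =>
      (η (f p)).flatMap (blockLetter m p) ++ blockEnd ι k p) =
      hashWord fun i => wreathNF η as (⟨fun a => f (i, some a), k i⟩ : WreathProd A H K) := by
  rw [hashWord_eq_flatMap, blockIndices, List.flatMap_assoc]
  refine List.flatMap_congr fun i _ => ?_
  have h : ∀ a, (η (f (i, some a))).flatMap (blockLetter (K := K) m (i, some a)) =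
      ((η (f (i, some a))).map (coordLetter K a)).map .inl := fun a => by
    rw [List.map_map]
    exact (List.map_eq_flatMap ..).symm
  have h' : (η (f (i, none))).flatMap (blockLetter (A := A) (K := K) m (i, none)) = [] := by
    simp [blockLetter]
  simp only [List.flatMap_append, List.flatMap_map, List.flatMap_singleton, h, h', wreathNF,
    List.map_append, List.map_flatMap]
  simp [blockEnd]

theorem isEDT0L_solutionLanguage_wreathNF [Finite A] [Finite K] [Finite ι]
    {η : H → List (ι × Bool)}
    (hsys : ∀ (n : ℕ) (E : Set (Monoid.Coprod H (FreeGroup (Fin n)))), E.Finite →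
      IsEDT0L (solutionLanguage η E))
    {as : List A} (has : as.Nodup) (hmem : ∀ a, a ∈ as) (m : ℕ)
    (E : Set (Monoid.Coprod (WreathProd A H K) (FreeGroup (Fin m)))) (hE : E.Finite) :
    IsEDT0L (solutionLanguage (wreathNF η as) E) := by
  classical
  let L := blockIndices m as
  let idx : Fin L.length ≃ Fin m × Option A :=
    (nodup_blockIndices m has).getEquivOfForallMemList L (mem_blockIndices hmem)
  let x : Fin m → A → Fin L.length := fun i a => idx.symm (i, some a)
  let J := {k : Fin m → K // ∀ e ∈ E, (expandHom (H := H) x k e).right = 1}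
  have hfin := finite_suffixes L
  let T : J → Transducer _ _ _ := fun j =>
    blockTransducer L (blockLetter (K := K) (ι := ι) m) (blockEnd ι j.1)
  have hW : ∀ (j : J) (f : Fin m × Option A → H),
      (T j).run ⟨L, List.suffix_rfl⟩ (hashWord fun n => η (f (idx n))) =
        hashWord fun i =>
          wreathNF η as (⟨fun a => f (i, some a), j.1 i⟩ : WreathProd A H K) := by
    intro j f
    rw [← flatMap_blockIndices]
    exact (congrArg _ (hashWord_get L fun p => η (f p))).trans
      (blockTransducer_run L _ _ (fun p => η (f p)) L List.suffix_rfl)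
  have h : solutionLanguage (wreathNF η as) E =
      {w | ∃ j : J, w ∈ (T j).run ⟨L, List.suffix_rfl⟩ ''
        solutionLanguage η (expandSystem x j.1 E)} := by
    ext w
    constructor
    · rintro ⟨g, hg, -, rfl⟩
      let f : Fin m × Option A → H := fun p => p.2.elim 1 (g p.1).left
      have hg' : g = fun i => (⟨fun a => f (idx (x i a)), (g i).right⟩ : WreathProd A H K) := by
        funext i
        simp [x, f]
      rw [hg', solvesSystem_wreath_iff x _ fun n => f (idx n)] at hg
      refine ⟨⟨_, hg.1⟩, _, ⟨fun n => f (idx n), hg.2, fun _ => trivial, rfl⟩, ?_⟩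
      rw [hW]
      rfl
    · rintro ⟨j, _, ⟨g, hg, -, rfl⟩, rfl⟩
      refine ⟨_, (solvesSystem_wreath_iff x j.1 g E).2 ⟨j.2, hg⟩, fun _ => trivial, ?_⟩
      have := hW j fun p => g (idx.symm p)
      simpa using this
  rw [h]
  exact IsEDT0L.iUnion fun j =>
    (hsys _ _ (finite_expandSystem x j.1 hE)).transduce (T j) _

end Systems
/-- If every finite system of equations in `H` has an EDT0L solution
language w.r.t. `η_H`, and `K` is a finite group acting on a finite set `A`, then the
wreath product `H ≀ K` has a finite generating set and normal form `η` w.r.t. which every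
finite system of equations has an EDT0L solution language; moreover `η` can be chosen so
that if `η_H` is regular then `η` is regular, and if `η_H` is quasigeodesic then `η` is
quasigeodesic. -/
theorem edt0l_wreath_product {H : Type} [Group H]
    {ιH : Type} [Fintype ιH] (genH : ιH → H)
    (hgenH : Subgroup.closure (Set.range genH) = ⊤)
    (ηH : H → List (ιH × Bool)) (hηH : ∀ h, evalWord genH (ηH h) = h)
    (hHsys : ∀ (m : ℕ) (E : Set (Monoid.Coprod H (FreeGroup (Fin m)))), E.Finite →
      IsEDT0L (solutionLanguage ηH E))
    (K : Type) [Group K] [Fintype K] (A : Type) [Fintype A] [MulAction K A] :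
    ∃ (ι : Type) (_ : Fintype ι) (gen : ι → WreathProd A H K)
      (η : WreathProd A H K → List (ι × Bool)),
      Subgroup.closure (Set.range gen) = ⊤ ∧
      (∀ w : WreathProd A H K, evalWord gen (η w) = w) ∧
      (∀ (m : ℕ) (E : Set (Monoid.Coprod (WreathProd A H K) (FreeGroup (Fin m)))),
        E.Finite → IsEDT0L (solutionLanguage η E)) ∧
      (IsRegularNF ηH → IsRegularNF η) ∧
      (IsQuasigeodesicNF genH ηH → IsQuasigeodesicNF gen η) := by
  classical
  have has : (Finset.univ : Finset A).toList.Nodup := Finset.nodup_toList _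
  have hmem : ∀ a, a ∈ (Finset.univ : Finset A).toList := by simp
  have heval := evalWord_wreathNF (K := K) genH ηH hηH _ has hmem
  refine ⟨(A × ιH) ⊕ K, inferInstance, wreathGen genH, wreathNF ηH Finset.univ.toList, ?_, heval,
    isEDT0L_solutionLanguage_wreathNF hHsys has hmem,
    fun h => isRegular_range_wreathNF h _ has,
    fun h => isQuasigeodesicNF_wreathNF genH h _ heval⟩
  exact (Subgroup.eq_top_iff' _).2 fun w => heval w ▸ evalWord_mem_closure _ _

end Paper
end

section
/- Let G be a finitely generated group with finite generating set Σ and normal form η such that the solution language of every finite system of equations in G with respect to η is EDT0L. Then for every finite system of equations with recognisable constraints in G, the solution language with respect to η is EDT0L. -/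
namespace Paper

section Regular

variable {β : Type}

/-- The state of an automaton after reading the image of a letter under a word of endomorphisms,
as a function of the letter and the initial state. -/
def letterAction {C κ Q : Type} (tab : κ → C → List C) (step : Q → C → Q) (φs : List κ) :
    C → Q → Q :=
  φs.foldr (fun i t c q => (tab i c).foldl (fun q' c' => t c' q') q) fun c q => step q c

theorem foldl_apply_eq_foldl_letterAction {α : Type*} (S : EDT0LSystem α) {Q : Type}
    (step : Q → S.C → Q) (φs : List S.ι) (w : List S.C) (q : Q) :
    (S.apply φs w).foldl step q =
      w.foldl (fun q' c => letterAction S.tab step φs c q') q := by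
  induction φs generalizing w with
  | nil => rfl
  | cons i φs ih =>
    have h := ih (subApply (S.tab i) w)
    rw [subApply, List.foldl_flatten, List.foldl_map] at h
    exact h

theorem isRegular_setOf_apply_mem {α : Type*} (S : EDT0LSystem α) {K : Language S.C}
    (hK : K.IsRegular) (w : List S.C) :
    Language.IsRegular ({φs | S.apply φs w ∈ K} : Language S.ι) := by
  classical
  obtain ⟨Q, _, M, rfl⟩ := hK
  have := S.finC
  let N : DFA S.ι (S.C → Q → Q) :=
    { step := fun t i c q => (S.tab i c).foldl (fun q' c' => t c' q') q
      start := fun c q => M.step q c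
      accept := {t | w.foldl (fun q c => t c q) M.start ∈ M.accept} }
  apply Language.IsRegular.of_reverse
  refine ⟨S.C → Q → Q, inferInstance, N, ?_⟩
  ext φs
  have h : N.eval φs = letterAction S.tab M.step φs.reverse := by
    rw [letterAction, List.foldr_reverse]
    rfl
  rw [DFA.mem_accepts, h]
  change _ ↔ (S.apply φs.reverse w).foldl M.step M.start ∈ M.accept
  rw [foldl_apply_eq_foldl_letterAction]
  rfl

/-- The words all of whose letters are kept by `f` and whose image under `f` lies in a regular
language form a regular language. -/
theorem isRegular_setOf_map_eq_map_some {C α : Type} (f : C → Option α) {L : Language α}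
    (hL : L.IsRegular) :
    Language.IsRegular ({v | ∃ w ∈ L, v.map f = w.map some} : Language C) := by
  obtain ⟨Q, _, M, rfl⟩ := hL
  let N : DFA C (Option Q) :=
    { step := fun s c => s.bind fun q => (f c).map (M.step q)
      start := some M.start
      accept := some '' M.accept }
  have none_eval (v : List C) : N.evalFrom none v = none := by
    induction v with
    | nil => rfl
    | cons c v ih => exact ih
  have key (v : List C) (q r : Q) : N.evalFrom (some q) v = some r ↔
      ∃ w, v.map f = w.map some ∧ M.evalFrom q w = r := by
    induction v generalizing q with
    | nil =>
      constructor
      · rintro h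
        exact ⟨[], rfl, Option.some_injective _ h⟩
      · rintro ⟨_ | ⟨b, w⟩, h, rfl⟩
        · rfl
        · simp at h
    | cons c v ih =>
      rw [DFA.evalFrom_cons]
      cases hc : f c with
      | none =>
        have : N.step (some q) c = none := by simp [N, hc]
        simp only [this, none_eval, reduceCtorEq, List.map_cons, hc, false_iff]
        rintro ⟨_ | ⟨a, w⟩, h, -⟩ <;> simp at h
      | some a =>
        have : N.step (some q) c = some (M.step q a) := by simp [N, hc]
        rw [this, ih]
        constructor
        · rintro ⟨w, h, hr⟩
          exact ⟨a :: w, by simp [h, hc], hr⟩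
        · rintro ⟨_ | ⟨b, w⟩, h, hr⟩
          · simp at h
          · simp only [List.map_cons, hc, List.cons.injEq, Option.some.injEq] at h
            obtain ⟨rfl, h⟩ := h
            exact ⟨w, h, hr⟩
  refine ⟨Option Q, inferInstance, N, ?_⟩
  ext v
  rw [DFA.mem_accepts]
  constructor
  · rintro ⟨r, hr, h⟩
    obtain ⟨w, hw, rfl⟩ := (key v M.start r).1 h.symm
    exact ⟨w, hr, hw⟩
  · rintro ⟨w, hw, h⟩
    exact ⟨_, hw, ((key v M.start _).2 ⟨w, h, rfl⟩).symm⟩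

/-- EDT0L languages are closed under intersection with regular languages. -/
theorem IsEDT0L.inf_isRegular {α : Type} {L K : Language α} (hL : IsEDT0L L)
    (hK : K.IsRegular) : IsEDT0L (L ⊓ K) := by
  obtain ⟨S, rfl⟩ := hL
  refine ⟨{ S with
    control := S.control ⊓
      {φs | S.apply φs S.start ∈ {v | ∃ w ∈ K, v.map S.term = w.map some}}
    control_reg := S.control_reg.inf
      (isRegular_setOf_apply_mem S (isRegular_setOf_map_eq_map_some S.term hK) S.start) }, ?_⟩
  ext w
  constructor
  · rintro ⟨φs, ⟨hφ, v, hv, h⟩, hw⟩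
    have hvw : v = w := List.map_injective_iff.2 (Option.some_injective α) (h.symm.trans hw)
    exact ⟨⟨φs, hφ, hw⟩, hvw ▸ hv⟩
  · rintro ⟨⟨φs, hφ, hw⟩, hK⟩
    exact ⟨φs, ⟨hφ, w, hK, hw⟩, hw⟩

/-- The `i`-th block of a word over `β ⊕ {#}`. -/
def block : ℕ → List (β ⊕ Unit) → List β
  | _, [] => []
  | 0, Sum.inl a :: w => a :: block 0 w
  | 0, Sum.inr _ :: _ => []
  | i + 1, Sum.inl _ :: w => block (i + 1) w
  | i + 1, Sum.inr _ :: w => block i w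

theorem block_zero_map_inl (u : List β) : block 0 (u.map Sum.inl) = u := by
  induction u with
  | nil => rfl
  | cons a u ih => simp [block, ih]

theorem block_zero_append (u : List β) (w : List (β ⊕ Unit)) :
    block 0 (u.map Sum.inl ++ Sum.inr () :: w) = u := by
  induction u with
  | nil => rfl
  | cons a u ih => simp [block, ih]

theorem block_succ_append (i : ℕ) (u : List β) (w : List (β ⊕ Unit)) :
    block (i + 1) (u.map Sum.inl ++ Sum.inr () :: w) = block i w := by
  induction u with
  | nil => rfl
  | cons a u ih => simp [block, ih]

theorem block_hashWord {m : ℕ} (ws : Fin m → List β) (i : Fin m) :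
    block i (hashWord ws) = ws i := by
  induction m with
  | zero => exact i.elim0
  | succ m ih =>
    cases m with
    | zero =>
      obtain rfl : i = 0 := Fin.fin_one_eq_zero i
      simp [hashWord, block_zero_map_inl]
    | succ m =>
      have h : hashWord ws = (ws 0).map Sum.inl ++
          Sum.inr () :: hashWord fun j : Fin (m + 1) => ws j.succ := by
        simp [hashWord, List.ofFn_succ]
      rw [h]
      refine Fin.cases ?_ (fun j => ?_) i
      · exact block_zero_append _ _
      · rw [Fin.val_succ, block_succ_append, ih]

theorem isRegular_setOf_block_mem {K : Language β} (hK : K.IsRegular) (i : ℕ) :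
    Language.IsRegular ({w | block i w ∈ K} : Language (β ⊕ Unit)) := by
  induction i with
  | zero =>
    obtain ⟨Q, _, M, rfl⟩ := hK
    let N : DFA (β ⊕ Unit) (Q ⊕ Q) :=
      { step := Sum.elim (fun q => Sum.elim (fun a => Sum.inl (M.step q a)) fun _ => Sum.inr q)
          fun q _ => Sum.inr q
        start := Sum.inl M.start
        accept := {s | s.elim id id ∈ M.accept} }
    have inr_eval (w : List (β ⊕ Unit)) (q : Q) : N.evalFrom (Sum.inr q) w = Sum.inr q := by
      induction w with
      | nil => rfl
      | cons a w ih => exact ih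
    have key (w : List (β ⊕ Unit)) (q : Q) :
        (N.evalFrom (Sum.inl q) w).elim id id = M.evalFrom q (block 0 w) := by
      induction w generalizing q with
      | nil => rfl
      | cons a w ih =>
        cases a with
        | inl a => exact ih _
        | inr a => exact congrArg (Sum.elim id id) (inr_eval w q)
    refine ⟨Q ⊕ Q, inferInstance, N, ?_⟩
    ext w
    change (N.evalFrom (Sum.inl M.start) w).elim id id ∈ M.accept ↔ _
    rw [key]
    rfl
  | succ i ih =>
    obtain ⟨Q, _, M, hM⟩ := ih
    let N : DFA (β ⊕ Unit) (Option Q) :=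
      { step := fun s a => s.elim (Sum.elim (fun _ => none) (fun _ => some M.start) a)
          fun q => some (M.step q a)
        start := none
        accept := {s | (s = none ∧ [] ∈ K) ∨ ∃ q ∈ M.accept, s = some q} }
    have some_eval (w : List (β ⊕ Unit)) (q : Q) :
        N.evalFrom (some q) w = some (M.evalFrom q w) := by
      induction w generalizing q with
      | nil => rfl
      | cons a w ih => exact ih _
    have key (w : List (β ⊕ Unit)) :
        N.evalFrom none w ∈ N.accept ↔ block (i + 1) w ∈ K := by
      induction w with
      | nil => simp [N, block]
      | cons a w ih =>
        cases a with
        | inl a => exact ih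
        | inr a =>
          change N.evalFrom (some M.start) w ∈ N.accept ↔ w ∈ ({w | block i w ∈ K} : Language _)
          rw [some_eval]
          rw [← hM]
          simp only [N, Set.mem_ofPred_eq, reduceCtorEq, false_and, false_or, Option.some.injEq,
            exists_eq_right']
          rfl
    exact ⟨Option Q, inferInstance, N, Set.ext key⟩

theorem isRegular_setOf_forall_mem {κ : Type*} (s : Finset κ) {L : κ → Language β}
    (hL : ∀ i, (L i).IsRegular) :
    Language.IsRegular ({w | ∀ i ∈ s, w ∈ L i} : Language β) := by
  classical
  induction s using Finset.induction_on with
  | empty =>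
    refine ⟨Unit, inferInstance, ⟨fun _ _ => (), (), Set.univ⟩, ?_⟩
    ext w
    exact ⟨fun _ i hi => absurd hi (Finset.notMem_empty i), fun _ => trivial⟩
  | insert i s _ ih =>
    have h : ({w | ∀ j ∈ insert i s, w ∈ L j} : Language β) =
        L i ⊓ ({w | ∀ j ∈ s, w ∈ L j} : Language β) :=
      Set.ext fun w => Finset.forall_mem_insert i s fun j => w ∈ L j
    exact h ▸ (hL i).inf ih

/-- Recognisability yields a regular preimage under evaluation with respect to any monoid
evaluation map, whatever generating set witnesses it. -/
theorem IsRecognisableSubset.isRegular {G : Type*} [Group G] {A : Set G}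
    (hA : IsRecognisableSubset A) (f : β → G) :
    Language.IsRegular ({w | (w.map f).prod ∈ A} : Language β) := by
  obtain ⟨κ, _, gen, hgen, Q, _, M, hM⟩ := hA
  have hsurj (g : G) : ∃ u : List κ, (u.map gen).prod = g := by
    have hg : g ∈ Submonoid.closure (Set.range gen) := hgen ▸ Submonoid.mem_top g
    rw [← FreeMonoid.mrange_lift] at hg
    obtain ⟨u, rfl⟩ := hg
    exact ⟨u.toList, (FreeMonoid.lift_apply gen u).symm⟩
  choose u hu using hsurj
  let N : DFA β Q := ⟨fun q a => M.evalFrom q (u (f a)), M.start, M.accept⟩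
  have key (w : List β) (q : Q) :
      N.evalFrom q w = M.evalFrom q (w.map fun a => u (f a)).flatten := by
    induction w generalizing q with
    | nil => rfl
    | cons a w ih =>
      rw [DFA.evalFrom_cons, ih, List.map_cons, List.flatten_cons, DFA.evalFrom_of_append]
  have hprod (w : List β) :
      ((w.map fun a => u (f a)).flatten.map gen).prod = (w.map f).prod := by
    induction w with
    | nil => rfl
    | cons a w ih =>
      rw [List.map_cons, List.flatten_cons, List.map_append, List.prod_append, hu, ih,
        List.map_cons, List.prod_cons]
  refine ⟨Q, inferInstance, N, ?_⟩
  ext w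
  change N.evalFrom M.start w ∈ M.accept ↔ (w.map f).prod ∈ A
  rw [key, ← hprod]
  change (w.map fun a => u (f a)).flatten ∈ M.accepts ↔ _
  rw [hM]
  rfl

end Regular

/-- If every finite system of equations in `G` has an EDT0L solution
language w.r.t. `η`, then every finite system of equations with recognisable constraints
in `G` has an EDT0L solution language w.r.t. `η`. -/
theorem edt0l_recognisable_constraints {G : Type} [Group G]
    {ι : Type} [Fintype ι] (gen : ι → G)
    (hgen : Subgroup.closure (Set.range gen) = ⊤)
    (η : G → List (ι × Bool)) (hη : ∀ g, evalWord gen (η g) = g)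
    (hGsys : ∀ (m : ℕ) (E : Set (Monoid.Coprod G (FreeGroup (Fin m)))), E.Finite →
      IsEDT0L (solutionLanguage η E)) :
    ∀ (m : ℕ) (E : Set (Monoid.Coprod G (FreeGroup (Fin m)))) (Rc : Fin m → Set G),
      E.Finite → (∀ i, IsRecognisableSubset (Rc i)) →
      IsEDT0L (solutionLanguageC η E Rc) := by
  intro m E Rc hE hRc
  have hreg : Language.IsRegular
      ({w | ∀ i ∈ (Finset.univ : Finset (Fin m)), w ∈
        ({w | block i w ∈ ({u | evalWord gen u ∈ Rc i} : Language (ι × Bool))} :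
          Language ((ι × Bool) ⊕ Unit))} : Language ((ι × Bool) ⊕ Unit)) :=
    isRegular_setOf_forall_mem _ fun i => isRegular_setOf_block_mem ((hRc i).isRegular _) i
  convert (hGsys m E hE).inf_isRegular hreg using 1
  ext w
  constructor
  · rintro ⟨g, hg, hgR, rfl⟩
    refine ⟨⟨g, hg, fun _ => trivial, rfl⟩, fun i _ => ?_⟩
    change evalWord gen (block i (hashWord fun i => η (g i))) ∈ Rc i
    rw [block_hashWord, hη]
    exact hgR i
  · rintro ⟨⟨g, hg, -, rfl⟩, hw⟩
    refine ⟨g, hg, fun i => ?_, rfl⟩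
    have h : evalWord gen (block i (hashWord fun i => η (g i))) ∈ Rc i := hw i (Finset.mem_univ i)
    rwa [block_hashWord, hη] at h

end Paper
end
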